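/- Let n ≥ 1, let Ω ⊂ ℍⁿ be a bounded open set, and let Σ be a non-empty open subset of S^{2n×2n} satisfying: (i) A ∈ Σ, B ∈ S^{2n×2n}, B positive definite imply A + B ∈ Σ; (ii) A ∈ Σ and c > 0 imply cA ∈ Σ. Let F[ψ] = ∇²_{H,s}ψ + L(ψ, ∇_H ψ) where L(s,p) = α p⊗p − γ Jp⊗Jp − β |p|² I₂ₙ with constants α, β, γ ∈ ℝ satisfying: either β > 0 and γ ≥ 0, or β < 0 and γ ≤ 0, or β = γ = 0. If w ∈ LSC(Ω̄) is a viscosity supersolution and v ∈ USC(Ω̄) is a viscosity subsolution of F[ψ] ∈ ∂Σ in Ω, and if w ≥ v on ∂Ω, then w ≥ v in Ω. -/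

import Mathlib

open Filter Topology Matrix Asymptotics

noncomputable section

/-- Points of the Heisenberg group `ℍⁿ`: `(x, y, t) ∈ ℝⁿ × ℝⁿ × ℝ`. -/
abbrev Heis (n : ℕ) : Type := (Fin n → ℝ) × (Fin n → ℝ) × ℝ

/-- Index type for the `2n` horizontal directions. -/
abbrev HIdx (n : ℕ) : Type := Fin n ⊕ Fin n

/-- `2n × 2n` real matrices. -/
abbrev HMat (n : ℕ) : Type := Matrix (HIdx n) (HIdx n) ℝ

namespace Heis

variable {n : ℕ}

/-- The Heisenberg group law. -/
def hmul (ξ η : Heis n) : Heis n :=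
  (ξ.1 + η.1, ξ.2.1 + η.2.1,
    ξ.2.2 + η.2.2 + 2 * ∑ i, (ξ.2.1 i * η.1 i - ξ.1 i * η.2.1 i))

/-- The group inverse `ξ⁻¹ = -ξ`. -/
def hinv (ξ : Heis n) : Heis n := (-ξ.1, -ξ.2.1, -ξ.2.2)

/-- `|z|²` for `ξ = (z, t)`. -/
def zsq (ξ : Heis n) : ℝ := ∑ i, (ξ.1 i ^ 2 + ξ.2.1 i ^ 2)

/-- The homogeneous norm `|ξ|_H = (|z|⁴ + t²)^{1/4}`. -/
def hnorm (ξ : Heis n) : ℝ := (zsq ξ ^ 2 + ξ.2.2 ^ 2) ^ ((1 : ℝ) / 4)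

/-- The left-invariant horizontal vector fields `X_j` (for `Sum.inl j`)
and `Y_j` (for `Sum.inr j`), as tangent vectors at `ξ`. -/
def vecField (j : HIdx n) (ξ : Heis n) : Heis n :=
  match j with
  | Sum.inl j => (Pi.single j 1, 0, 2 * ξ.2.1 j)
  | Sum.inr j => (0, Pi.single j 1, -(2 * ξ.1 j))

/-- Horizontal (Heisenberg) gradient `∇_H ψ (ξ) ∈ ℝ^{2n}`. -/
def hGrad (ψ : Heis n → ℝ) (ξ : Heis n) : HIdx n → ℝ :=
  fun j => fderiv ℝ ψ ξ (vecField j ξ)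

/-- Heisenberg Hessian: entry `(i, j)` is `(field j)((field i) ψ)(ξ)`. -/
def hHess (ψ : Heis n → ℝ) (ξ : Heis n) : HMat n :=
  Matrix.of fun i j =>
    fderiv ℝ (fun η => fderiv ℝ ψ η (vecField i η)) ξ (vecField j ξ)

/-- Symmetrized Heisenberg Hessian `∇²_{H,s} ψ`. -/
def hHessSym (ψ : Heis n → ℝ) (ξ : Heis n) : HMat n :=
  ((1 : ℝ) / 2) • (hHess ψ ξ + (hHess ψ ξ)ᵀ)

/-- The standard symplectic matrix `J = [[0, Iₙ], [-Iₙ, 0]]`. -/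
def Jmat (n : ℕ) : HMat n :=
  Matrix.of fun i j =>
    match i, j with
    | Sum.inl a, Sum.inr b => if a = b then (1 : ℝ) else 0
    | Sum.inr a, Sum.inl b => if a = b then (-1 : ℝ) else 0
    | _, _ => 0

/-- Euclidean norm of `p ∈ ℝ^{2n}`. -/
def pnorm (p : HIdx n → ℝ) : ℝ := Real.sqrt (∑ j, p j ^ 2)

/-- The Loewner (positive semidefinite) order on matrices. -/
def matLE (A B : HMat n) : Prop := (B - A).PosSemidef

/-- The operator `F[ψ] = ∇²_{H,s} ψ + L(·, ψ, ∇_H ψ)`. -/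
def Fop (L : Heis n → ℝ → (HIdx n → ℝ) → HMat n) (ψ : Heis n → ℝ) (ξ : Heis n) : HMat n :=
  hHessSym ψ ξ + L ξ (ψ ξ) (hGrad ψ ξ)

/-- Viscosity subsolution of `F[ψ] ∈ ∂Σ` in `Ω`: `F[ψ] ∈ closure Σ`
in the viscosity sense. -/
def IsSubsolution (Ω : Set (Heis n)) (L : Heis n → ℝ → (HIdx n → ℝ) → HMat n)
    (S : Set (HMat n)) (v : Heis n → EReal) : Prop :=
  ∀ ξ₀ ∈ Ω, ∀ φ : Heis n → ℝ, ContDiffOn ℝ 2 φ Ω → v ξ₀ = ((φ ξ₀ : ℝ) : EReal) →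
    (∀ᶠ η in nhds ξ₀, η ∈ Ω → v η ≤ ((φ η : ℝ) : EReal)) →
    Fop L φ ξ₀ ∈ closure S

/-- Viscosity supersolution of `F[ψ] ∈ ∂Σ` in `Ω`: `F[ψ] ∈ S^{2n×2n} ∖ Σ`
in the viscosity sense. -/
def IsSupersolution (Ω : Set (Heis n)) (L : Heis n → ℝ → (HIdx n → ℝ) → HMat n)
    (S : Set (HMat n)) (w : Heis n → EReal) : Prop :=
  ∀ ξ₀ ∈ Ω, ∀ φ : Heis n → ℝ, ContDiffOn ℝ 2 φ Ω → w ξ₀ = ((φ ξ₀ : ℝ) : EReal) →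
    (∀ᶠ η in nhds ξ₀, η ∈ Ω → ((φ η : ℝ) : EReal) ≤ w η) →
    Fop L φ ξ₀ ∉ S

/-- The class `USC(s)`: upper semicontinuous, valued in `ℝ ∪ {-∞}`, not identically `-∞`. -/
def USCFun (s : Set (Heis n)) (v : Heis n → EReal) : Prop :=
  UpperSemicontinuousOn v s ∧ (∀ ξ ∈ s, v ξ ≠ ⊤) ∧ (∃ ξ ∈ s, v ξ ≠ ⊥)

/-- The class `LSC(s)`: lower semicontinuous, valued in `ℝ ∪ {+∞}`, not identically `+∞`. -/
def LSCFun (s : Set (Heis n)) (w : Heis n → EReal) : Prop :=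
  LowerSemicontinuousOn w s ∧ (∀ ξ ∈ s, w ξ ≠ ⊥) ∧ (∃ ξ ∈ s, w ξ ≠ ⊤)

/-- `Σ` is (relatively) open as a subset of the space of symmetric matrices. -/
def RelOpen (S : Set (HMat n)) : Prop :=
  IsOpen {A : {M : HMat n // M.IsSymm} | A.1 ∈ S}

/-- The quadratic lower-order term
`L(ξ,s,p) = α(ξ,s) p⊗p - γ(ξ,s) Jp⊗Jp - β(ξ,s)|p|² I₂ₙ`. -/
def Lquad (α β γ : Heis n → ℝ → ℝ) : Heis n → ℝ → (HIdx n → ℝ) → HMat n :=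
  fun ξ s p =>
    α ξ s • vecMulVec p p - γ ξ s • vecMulVec (Jmat n *ᵥ p) (Jmat n *ᵥ p)
      - (β ξ s * ∑ j, p j ^ 2) • (1 : HMat n)

/-- The quadratic lower-order term with constant coefficients
`L(s,p) = a p⊗p - c Jp⊗Jp - b|p|² I₂ₙ`. -/
def LquadC (a b c : ℝ) : Heis n → ℝ → (HIdx n → ℝ) → HMat n :=
  fun _ _ p =>
    a • vecMulVec p p - c • vecMulVec (Jmat n *ᵥ p) (Jmat n *ᵥ p)
      - (b * ∑ j, p j ^ 2) • (1 : HMat n)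

/-- Locally Lipschitz on a set. -/
def LocallyLipschitzOnSet {X : Type*} [PseudoMetricSpace X] (s : Set X) (f : X → ℝ) : Prop :=
  ∀ x ∈ s, ∃ K : NNReal, ∃ t ∈ nhdsWithin x s, LipschitzOnWith K f t

/-- All entries of `L(ξ,s,·)` are differentiable at `p`. -/
def DiffInP (L : Heis n → ℝ → (HIdx n → ℝ) → HMat n) (ξ : Heis n) (s : ℝ)
    (p : HIdx n → ℝ) : Prop :=
  ∀ i j, DifferentiableAt ℝ (fun q => L ξ s q i j) p

/-- All entries of `L(·,s,p)` are differentiable at `ξ`. -/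
def DiffInXi (L : Heis n → ℝ → (HIdx n → ℝ) → HMat n) (ξ : Heis n) (s : ℝ)
    (p : HIdx n → ℝ) : Prop :=
  ∀ i j, DifferentiableAt ℝ (fun η => L η s p i j) ξ

/-- A norm of `∇_p L(ξ,s,p)`. -/
def pGradNorm (L : Heis n → ℝ → (HIdx n → ℝ) → HMat n) (ξ : Heis n) (s : ℝ)
    (p : HIdx n → ℝ) : ℝ :=
  Real.sqrt (∑ i, ∑ j, ∑ k, (fderiv ℝ (fun q => L ξ s q i j) p (Pi.single k 1)) ^ 2)

/-- A norm of `∇_ξ L(ξ,s,p)`. -/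
def xiGradNorm (L : Heis n → ℝ → (HIdx n → ℝ) → HMat n) (ξ : Heis n) (s : ℝ)
    (p : HIdx n → ℝ) : ℝ :=
  Real.sqrt (∑ i : HIdx n, ∑ j : HIdx n, ‖fderiv ℝ (fun η => L η s p i j) ξ‖ ^ 2)

/-- The matrix `p · ∇_p L(ξ,s,p)`. -/
def pDotGradL (L : Heis n → ℝ → (HIdx n → ℝ) → HMat n) (ξ : Heis n) (s : ℝ)
    (p : HIdx n → ℝ) : HMat n :=
  Matrix.of fun i j => fderiv ℝ (fun q => L ξ s q i j) p p

/-- Structural condition (3.3): `|∇_ξ L(ξ,s,p)| ≤ C|p|^m` and `|∇_p L(ξ,s,p)| ≤ C|p|`. -/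
def Cond33 (Ω : Set (Heis n)) (L : Heis n → ℝ → (HIdx n → ℝ) → HMat n) (m : ℝ) : Prop :=
  ∀ R : ℝ, 0 < R → ∃ C : ℝ, 0 < C ∧ ∀ ξ ∈ Ω, ∀ s : ℝ, |s| ≤ R → ∀ p : HIdx n → ℝ,
    (DiffInXi L ξ s p → xiGradNorm L ξ s p ≤ C * pnorm p ^ m) ∧
    (DiffInP L ξ s p → pGradNorm L ξ s p ≤ C * pnorm p)

/-- Structural condition (3.4): `0 ≤ L(ξ,s',p) - L(ξ,s,p) ≤ C(s'-s)|p|^m I₂ₙ`. -/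
def Cond34 (Ω : Set (Heis n)) (L : Heis n → ℝ → (HIdx n → ℝ) → HMat n) (m : ℝ) : Prop :=
  ∀ R : ℝ, 0 < R → ∃ C : ℝ, 0 < C ∧ ∀ ξ ∈ Ω, ∀ s s' : ℝ, -R ≤ s → s ≤ s' → s' ≤ R →
    ∀ p : HIdx n → ℝ,
      matLE 0 (L ξ s' p - L ξ s p) ∧
      matLE (L ξ s' p - L ξ s p) ((C * (s' - s) * pnorm p ^ m) • (1 : HMat n))

/-- The second inequality of condition (3.4): `L(ξ,s',p) - L(ξ,s,p) ≤ C(s'-s)|p|^m I₂ₙ`. -/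
def Cond34Upper (Ω : Set (Heis n)) (L : Heis n → ℝ → (HIdx n → ℝ) → HMat n) (m : ℝ) : Prop :=
  ∀ R : ℝ, 0 < R → ∃ C : ℝ, 0 < C ∧ ∀ ξ ∈ Ω, ∀ s s' : ℝ, -R ≤ s → s ≤ s' → s' ≤ R →
    ∀ p : HIdx n → ℝ,
      matLE (L ξ s' p - L ξ s p) ((C * (s' - s) * pnorm p ^ m) • (1 : HMat n))

/-- Structural condition (3.5). -/
def Cond35 (Ω : Set (Heis n)) (L : Heis n → ℝ → (HIdx n → ℝ) → HMat n) (m : ℝ) : Prop :=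
  ∀ R : ℝ, 0 < R → ∀ Λ : ℝ, 0 < Λ → ∃ θb : ℝ, 0 < θb ∧ ∃ C : ℝ, 0 < C ∧
    ∀ θ : ℝ, 0 ≤ θ → θ ≤ θb → ∀ ξ ∈ Ω, ∀ s : ℝ, |s| ≤ R → ∀ p : HIdx n → ℝ,
      DiffInP L ξ s p →
      matLE (pDotGradL L ξ s p - L ξ s p + (θ * Λ * pGradNorm L ξ s p) • (1 : HMat n)
              - θ • (1 : HMat n))
            (C • vecMulVec p p - ((1 / C) * pnorm p ^ m) • (1 : HMat n))

/-- Structural condition (3.7). -/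
def Cond37 (Ω : Set (Heis n)) (L : Heis n → ℝ → (HIdx n → ℝ) → HMat n) (m : ℝ) : Prop :=
  ∀ R : ℝ, 0 < R → ∀ Λ : ℝ, 0 < Λ → ∃ θb : ℝ, 0 < θb ∧ ∃ C : ℝ, 0 < C ∧
    ∀ θ : ℝ, 0 < θ → θ ≤ θb → ∀ ξ ∈ Ω, ∀ s : ℝ, |s| ≤ R → ∀ p : HIdx n → ℝ,
      DiffInP L ξ s p →
      matLE ((-C) • vecMulVec p p + ((1 / C) * pnorm p ^ m) • (1 : HMat n))
            (pDotGradL L ξ s p - L ξ s p - (θ * Λ * pGradNorm L ξ s p) • (1 : HMat n)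
              + θ • (1 : HMat n))

/-- `P` is a second-order Taylor witness for `u` at `ξ`: `u` is punctually second order
differentiable at `ξ` with expansion given by the `C²` function `P`. -/
def PunctualWitness (u P : Heis n → ℝ) (ξ : Heis n) : Prop :=
  ContDiff ℝ 2 P ∧ P ξ = u ξ ∧
    (fun η => u η - P η) =o[nhds ξ] (fun η => ‖η - ξ‖ ^ 2)

/-- The `ε`-lower envelope `w_ε`. -/
def lowerEnv (Ω : Set (Heis n)) (w : Heis n → EReal) (ε : ℝ) (ξ : Heis n) : EReal :=
  ⨅ η ∈ closure Ω, (w η + (((1 / ε) * hnorm (hmul (hinv η) ξ) ^ 4 : ℝ) : EReal))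

/-- The `ε`-upper envelope `v^ε`. -/
def upperEnv (Ω : Set (Heis n)) (v : Heis n → EReal) (ε : ℝ) (ξ : Heis n) : EReal :=
  ⨆ η ∈ closure Ω, (v η - (((1 / ε) * hnorm (hmul (hinv η) ξ) ^ 4 : ℝ) : EReal))

/-- The `ε`-lower envelope, as a real valued function. -/
def lowerEnvR (Ω : Set (Heis n)) (w : Heis n → EReal) (ε : ℝ) (ξ : Heis n) : ℝ :=
  (lowerEnv Ω w ε ξ).toReal

/-- The `ε`-upper envelope, as a real valued function. -/
def upperEnvR (Ω : Set (Heis n)) (v : Heis n → EReal) (ε : ℝ) (ξ : Heis n) : ℝ :=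
  (upperEnv Ω v ε ξ).toReal

/-- The lower semicontinuous envelope `g_*` relative to `O`. -/
def lscEnv (O : Set (Heis n)) (g : Heis n → EReal) (ξ : Heis n) : EReal :=
  ⨆ (r : ℝ) (_ : 0 < r), ⨅ η ∈ O ∩ Metric.ball ξ r, g η

/-- The upper semicontinuous envelope `g^*` relative to `O`. -/
def uscEnv (O : Set (Heis n)) (g : Heis n → EReal) (ξ : Heis n) : EReal :=
  ⨅ (r : ℝ) (_ : 0 < r), ⨆ η ∈ O ∩ Metric.ball ξ r, g η

end Heis

open Heis

section JensenAlexandrov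

open MeasureTheory Metric
open scoped Pointwise

variable {E : Type*} [NormedAddCommGroup E] [NormedSpace ℝ E]

/-- If a functional is bounded by `D * s` on the ball of radius `s`, its norm is at most `D`. -/
lemma ja_norm_le {φ : E →L[ℝ] ℝ} {s D : ℝ} (hs : 0 < s)
    (h : ∀ x, ‖x‖ ≤ s → φ x ≤ D * s) : ‖φ‖ ≤ D := by
  have hD : 0 ≤ D := by
    have := h 0 (by simpa using hs.le)
    simp only [map_zero] at this
    by_contra hc
    push Not at hc
    nlinarith
  have key : ∀ x, φ x ≤ D * ‖x‖ := by
    intro x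
    by_cases hx : x = 0
    · simp [hx]
    have hx' : 0 < ‖x‖ := norm_pos_iff.2 hx
    have h1 := h ((s / ‖x‖) • x) (by
      rw [norm_smul, Real.norm_of_nonneg (by positivity)]
      rw [div_mul_cancel₀ _ hx'.ne'])
    rw [map_smul, smul_eq_mul] at h1
    have h2 : s / ‖x‖ * φ x * ‖x‖ = s * φ x := by field_simp
    have h3 : s / ‖x‖ * φ x * ‖x‖ ≤ D * s * ‖x‖ := mul_le_mul_of_nonneg_right h1 hx'.le
    rw [h2] at h3
    have h4 : s * φ x ≤ s * (D * ‖x‖) := by linarith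
    exact le_of_mul_le_mul_left h4 hs
  refine ContinuousLinearMap.opNorm_le_bound _ hD fun x => ?_
  rw [Real.norm_eq_abs, abs_le]
  have := key (-x)
  rw [map_neg, norm_neg] at this
  exact ⟨by linarith, key x⟩

lemma ja_eq_zero {φ : E →L[ℝ] ℝ} {d C : ℝ} (hd : 0 < d)
    (h : ∀ x, ‖x‖ ≤ d → φ x ≤ C * ‖x‖ ^ 2) : φ = 0 := by
  rw [← norm_le_zero_iff]
  refine le_of_forall_pos_le_add fun ε hε => ?_
  rw [zero_add]
  set s := min d (ε / (|C| + 1)) with hsdef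
  have hs : 0 < s := lt_min hd (by positivity)
  have hs2 : |C| * s ≤ ε := by
    have : s ≤ ε / (|C| + 1) := min_le_right _ _
    rw [le_div_iff₀ (by positivity)] at this
    nlinarith
  refine ja_norm_le hs fun x hx => ?_
  have h1 := h x (hx.trans (min_le_left _ _))
  have h2 : C * ‖x‖ ^ 2 ≤ |C| * s ^ 2 := by
    have := pow_le_pow_left₀ (norm_nonneg x) hx 2
    have h3 := le_abs_self C
    have h4 := abs_nonneg C
    nlinarith [sq_nonneg ‖x‖]
  nlinarith

/-- Comparison of slopes. -/
lemma ja_slope {f : E → ℝ} {q : E → (E →L[ℝ] ℝ)} {Kb : Set E} {C : ℝ}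
    {x y : E} {s : ℝ} (hC : 0 ≤ C) (hs : 0 < s) (hxy : ‖x - y‖ ≤ s)
    (hx : closedBall x s ⊆ Kb)
    (hlx : ∀ z ∈ Kb, f x + q x (z - x) - C * ‖z - x‖ ^ 2 ≤ f z)
    (hly : ∀ z ∈ Kb, f y + q y (z - y) - C * ‖z - y‖ ^ 2 ≤ f z)
    (huy : ∀ z ∈ Kb, f z ≤ f y + q y (z - y) + C * ‖z - y‖ ^ 2) :
    ‖q x - q y‖ ≤ 6 * C * s := by
  refine ja_norm_le hs fun h hh => ?_
  have hm : x + h ∈ Kb := hx (by simpa using hh)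
  have h1 := hlx _ hm
  have h2 := hly x (hx (by simp [hs.le]))
  have h3 := huy _ hm
  have e1 : x + h - x = h := by abel
  have e2 : x + h - y = (x - y) + h := by abel
  rw [e1] at h1
  rw [e2, map_add] at h3
  have n1 : ‖x - y + h‖ ≤ 2 * s := (norm_add_le _ _).trans (by linarith)
  have n2 := pow_le_pow_left₀ (norm_nonneg _) n1 2
  have n3 := pow_le_pow_left₀ (norm_nonneg _) hxy 2
  have n4 := pow_le_pow_left₀ (norm_nonneg _) hh 2
  have m2 := mul_le_mul_of_nonneg_left n2 hC
  have m3 := mul_le_mul_of_nonneg_left n3 hC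
  have m4 := mul_le_mul_of_nonneg_left n4 hC
  rw [_root_.sub_apply]
  nlinarith

/-- Second-order expansion from the first-order expansion of the slopes. -/
lemma ja_expand_upper {f : E → ℝ} {q : E → (E →L[ℝ] ℝ)} {x h : E} {C ε : ℝ}
    {A : E →L[ℝ] (E →L[ℝ] ℝ)} (hε : 0 ≤ ε) (N : ℕ) (hN : 0 < N)
    (hl : ∀ t ∈ Set.Icc (0:ℝ) 1, ∀ t' ∈ Set.Icc (0:ℝ) 1,
      f (x + t • h) + q (x + t • h) ((t' - t) • h) - C * ‖(t' - t) • h‖ ^ 2 ≤ f (x + t' • h))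
    (hq : ∀ t ∈ Set.Icc (0:ℝ) 1, ‖q (x + t • h) - q x - A (t • h)‖ ≤ ε * ‖t • h‖) :
    f (x + h) ≤ f x + q x h + 1 / 2 * A h h + (1 / (2 * N)) * A h h + ε * ‖h‖ ^ 2
      + C * ‖h‖ ^ 2 / N := by
  have hN' : (0:ℝ) < N := by exact_mod_cast hN
  have key : ∀ i : ℕ, i ≤ N → f (x + ((i:ℝ) / N) • h) ≤ f x + (i / N) * q x h
      + (i * (i + 1) / (2 * N ^ 2)) * A h h + (i / N) * (ε * ‖h‖ ^ 2)
      + i * (C * ‖h‖ ^ 2 / N ^ 2) := by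
    intro i
    induction i with
    | zero => intro _; simp
    | succ i ih =>
      intro hi
      have h1 := ih (by omega)
      have hi' : ((i:ℝ) + 1) ≤ N := by exact_mod_cast hi
      have i0 : (0:ℝ) ≤ i := Nat.cast_nonneg i
      have ht : ((i + 1 : ℕ) : ℝ) / N ∈ Set.Icc (0:ℝ) 1 := by
        push_cast
        exact ⟨by positivity, by rw [div_le_one hN']; exact hi'⟩
      have ht' : (i : ℝ) / N ∈ Set.Icc (0:ℝ) 1 :=
        ⟨by positivity, by rw [div_le_one hN']; linarith⟩
      have h2 := hl _ ht _ ht'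
      have e1 : (i : ℝ) / N - ((i + 1 : ℕ) : ℝ) / N = - (1 / N) := by
        push_cast; field_simp; ring
      rw [e1] at h2
      have h3 := hq _ ht
      set z := x + (((i + 1 : ℕ) : ℝ) / N) • h with hz
      have h4 : (q z - q x - A ((((i + 1 : ℕ) : ℝ) / N) • h)) h ≤ ε * ‖h‖ ^ 2 := by
        calc _ ≤ ‖(q z - q x - A ((((i + 1 : ℕ) : ℝ) / N) • h)) h‖ := Real.le_norm_self _
          _ ≤ ‖(q z - q x - A ((((i + 1 : ℕ) : ℝ) / N) • h))‖ * ‖h‖ :=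
            ContinuousLinearMap.le_opNorm _ _
          _ ≤ (ε * ‖((((i + 1 : ℕ) : ℝ) / N) • h)‖) * ‖h‖ := by gcongr
          _ ≤ (ε * ‖h‖) * ‖h‖ := by
            gcongr
            rw [norm_smul, Real.norm_of_nonneg ht.1]
            exact mul_le_of_le_one_left (norm_nonneg _) ht.2
          _ = _ := by ring
      simp only [_root_.sub_apply, map_smul, _root_.smul_apply,
        smul_eq_mul, norm_smul, norm_neg, Real.norm_of_nonneg (show (0:ℝ) ≤ 1 / N by positivity)]
        at h4 h2
      have e2 : C * ((1:ℝ) / N * ‖h‖) ^ 2 = C * ‖h‖ ^ 2 / N ^ 2 := by field_simp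
      rw [e2] at h2
      have h5 : (1 / N) * (q z) h ≤ (1 / N) * (ε * ‖h‖ ^ 2 + q x h
          + (((i + 1 : ℕ) : ℝ) / N) * A h h) := by
        apply mul_le_mul_of_nonneg_left _ (by positivity)
        linarith
      have e3 : f x + ((i + 1 : ℕ) / N) * q x h
        + ((i + 1 : ℕ) * ((i + 1 : ℕ) + 1) / (2 * N ^ 2)) * A h h
        + ((i + 1 : ℕ) / N) * (ε * ‖h‖ ^ 2) + (i + 1 : ℕ) * (C * ‖h‖ ^ 2 / N ^ 2)
        = (f x + (i / N) * q x h
        + (i * (i + 1) / (2 * N ^ 2)) * A h h + (i / N) * (ε * ‖h‖ ^ 2)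
        + i * (C * ‖h‖ ^ 2 / N ^ 2)) + (1 / N) * (ε * ‖h‖ ^ 2 + q x h
          + (((i + 1 : ℕ) : ℝ) / N) * A h h) + C * ‖h‖ ^ 2 / N ^ 2 := by
        push_cast; field_simp; ring
      rw [e3]
      linarith
  have := key N le_rfl
  rw [div_self hN'.ne', one_smul] at this
  refine this.trans (le_of_eq ?_)
  field_simp
  ring

lemma ja_expand_lower {f : E → ℝ} {q : E → (E →L[ℝ] ℝ)} {x h : E} {C ε : ℝ}
    {A : E →L[ℝ] (E →L[ℝ] ℝ)} (hε : 0 ≤ ε) (N : ℕ) (hN : 0 < N)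
    (hl : ∀ t ∈ Set.Icc (0:ℝ) 1, ∀ t' ∈ Set.Icc (0:ℝ) 1,
      f (x + t • h) + q (x + t • h) ((t' - t) • h) - C * ‖(t' - t) • h‖ ^ 2 ≤ f (x + t' • h))
    (hq : ∀ t ∈ Set.Icc (0:ℝ) 1, ‖q (x + t • h) - q x - A (t • h)‖ ≤ ε * ‖t • h‖) :
    f x + q x h + 1 / 2 * A h h - (1 / (2 * N)) * A h h - ε * ‖h‖ ^ 2
      - C * ‖h‖ ^ 2 / N ≤ f (x + h) := by
  have hN' : (0:ℝ) < N := by exact_mod_cast hN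
  have key : ∀ i : ℕ, i ≤ N → f x + (i / N) * q x h
      + (i * (i - 1) / (2 * N ^ 2)) * A h h - (i / N) * (ε * ‖h‖ ^ 2)
      - i * (C * ‖h‖ ^ 2 / N ^ 2) ≤ f (x + ((i:ℝ) / N) • h) := by
    intro i
    induction i with
    | zero => intro _; simp
    | succ i ih =>
      intro hi
      have h1 := ih (by omega)
      have hi' : ((i:ℝ) + 1) ≤ N := by exact_mod_cast hi
      have i0 : (0:ℝ) ≤ i := Nat.cast_nonneg i
      have ht' : ((i + 1 : ℕ) : ℝ) / N ∈ Set.Icc (0:ℝ) 1 := by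
        push_cast
        exact ⟨by positivity, by rw [div_le_one hN']; exact hi'⟩
      have ht : (i : ℝ) / N ∈ Set.Icc (0:ℝ) 1 :=
        ⟨by positivity, by rw [div_le_one hN']; linarith⟩
      have h2 := hl _ ht _ ht'
      have e1 : ((i + 1 : ℕ) : ℝ) / N - (i : ℝ) / N = (1 / N) := by
        push_cast; field_simp; ring
      rw [e1] at h2
      have h3 := hq _ ht
      set z := x + ((i : ℝ) / N) • h with hz
      have h4 : -(ε * ‖h‖ ^ 2) ≤ (q z - q x - A (((i : ℝ) / N) • h)) h := by
        have : ‖(q z - q x - A (((i : ℝ) / N) • h)) h‖ ≤ ε * ‖h‖ ^ 2 := by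
          calc _ ≤ ‖(q z - q x - A (((i : ℝ) / N) • h))‖ * ‖h‖ :=
              ContinuousLinearMap.le_opNorm _ _
            _ ≤ (ε * ‖(((i : ℝ) / N) • h)‖) * ‖h‖ := by gcongr
            _ ≤ (ε * ‖h‖) * ‖h‖ := by
              gcongr
              rw [norm_smul, Real.norm_of_nonneg ht.1]
              exact mul_le_of_le_one_left (norm_nonneg _) ht.2
            _ = _ := by ring
        rw [Real.norm_eq_abs] at this
        exact (abs_le.1 this).1
      simp only [_root_.sub_apply, map_smul, _root_.smul_apply,
        smul_eq_mul, norm_smul, Real.norm_of_nonneg (show (0:ℝ) ≤ 1 / N by positivity)]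
        at h4 h2
      have e2 : C * ((1:ℝ) / N * ‖h‖) ^ 2 = C * ‖h‖ ^ 2 / N ^ 2 := by field_simp
      rw [e2] at h2
      have h5 : (1 / N) * (-(ε * ‖h‖ ^ 2) + q x h
          + ((i : ℝ) / N) * A h h) ≤ (1 / N) * (q z) h := by
        apply mul_le_mul_of_nonneg_left _ (by positivity)
        linarith
      have e3 : f x + ((i + 1 : ℕ) / N) * q x h
        + ((i + 1 : ℕ) * ((i + 1 : ℕ) - 1) / (2 * N ^ 2)) * A h h
        - ((i + 1 : ℕ) / N) * (ε * ‖h‖ ^ 2) - (i + 1 : ℕ) * (C * ‖h‖ ^ 2 / N ^ 2)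
        = (f x + (i / N) * q x h
        + (i * (i - 1) / (2 * N ^ 2)) * A h h - (i / N) * (ε * ‖h‖ ^ 2)
        - i * (C * ‖h‖ ^ 2 / N ^ 2)) + (1 / N) * (-(ε * ‖h‖ ^ 2) + q x h
          + ((i : ℝ) / N) * A h h) - C * ‖h‖ ^ 2 / N ^ 2 := by
        push_cast; field_simp; ring
      rw [e3]
      linarith
  have := key N le_rfl
  rw [div_self hN'.ne', one_smul] at this
  refine le_trans (le_of_eq ?_) this
  field_simp
  ring

/-- Full second-order expansion at a point where slopes are differentiable. -/
lemma ja_expand {f : E → ℝ} {q : E → (E →L[ℝ] ℝ)} {x : E} {C d : ℝ} {Kb : Set E}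
    {A : E →L[ℝ] (E →L[ℝ] ℝ)} (hd : 0 < d) (hC : 0 ≤ C) (hx : closedBall x d ⊆ Kb)
    (hl : ∀ z ∈ Kb, ∀ y ∈ Kb, f z + q z (y - z) - C * ‖y - z‖ ^ 2 ≤ f y)
    (hq : ∀ ε > 0, ∃ δ > 0, ∀ z, ‖z - x‖ ≤ δ → ‖q z - q x - A (z - x)‖ ≤ ε * ‖z - x‖)
    {ε : ℝ} (hε : 0 < ε) :
    ∃ δ > 0, δ ≤ d ∧ ∀ h, ‖h‖ ≤ δ → |f (x + h) - f x - q x h - 1 / 2 * A h h| ≤ ε * ‖h‖ ^ 2 := by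
  obtain ⟨δ, hδ, hδq⟩ := hq (ε / 2) (by positivity)
  obtain ⟨N, hN⟩ := exists_nat_gt ((‖A‖ + C) / (ε / 2))
  have hN' : (0:ℝ) < N := lt_of_le_of_lt (by positivity) hN
  rw [div_lt_iff₀ (by positivity)] at hN
  refine ⟨min δ d, lt_min hδ hd, min_le_right _ _, fun h hh => ?_⟩
  have hmem : ∀ t ∈ Set.Icc (0:ℝ) 1, ‖t • h‖ ≤ ‖h‖ := by
    intro t ht
    rw [norm_smul, Real.norm_of_nonneg ht.1]
    exact mul_le_of_le_one_left (norm_nonneg _) ht.2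
  have hKm : ∀ t ∈ Set.Icc (0:ℝ) 1, x + t • h ∈ Kb := by
    intro t ht
    apply hx
    rw [mem_closedBall, dist_eq_norm, add_sub_cancel_left]
    exact (hmem t ht).trans (hh.trans (min_le_right _ _))
  have hl' : ∀ t ∈ Set.Icc (0:ℝ) 1, ∀ t' ∈ Set.Icc (0:ℝ) 1,
      f (x + t • h) + q (x + t • h) ((t' - t) • h) - C * ‖(t' - t) • h‖ ^ 2 ≤ f (x + t' • h) := by
    intro t ht t' ht'
    have := hl _ (hKm t ht) _ (hKm t' ht')
    have e : x + t' • h - (x + t • h) = (t' - t) • h := by rw [sub_smul]; abel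
    rwa [e] at this
  have hq' : ∀ t ∈ Set.Icc (0:ℝ) 1, ‖q (x + t • h) - q x - A (t • h)‖ ≤ ε / 2 * ‖t • h‖ := by
    intro t ht
    have := hδq (x + t • h) (by
      rw [add_sub_cancel_left]; exact (hmem t ht).trans (hh.trans (min_le_left _ _)))
    rwa [add_sub_cancel_left] at this
  have hNN : 0 < N := by exact_mod_cast hN'
  have u := ja_expand_upper (by positivity) N hNN hl' hq'
  have l := ja_expand_lower (by positivity) N hNN hl' hq'
  have hA : |A h h| ≤ ‖A‖ * ‖h‖ ^ 2 := by
    have := A.le_opNorm₂ h h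
    rw [Real.norm_eq_abs] at this
    nlinarith
  have hA2 : |(1 / (2 * N)) * A h h| ≤ ‖A‖ * ‖h‖ ^ 2 / N := by
    rw [abs_mul, abs_of_nonneg (by positivity), le_div_iff₀ hN']
    have : 1 / (2 * (N:ℝ)) * |A h h| * N = 1 / 2 * |A h h| := by field_simp
    rw [this]
    have := abs_nonneg (A h h)
    linarith
  have hfin : ‖A‖ * ‖h‖ ^ 2 / N + C * ‖h‖ ^ 2 / N ≤ ε / 2 * ‖h‖ ^ 2 := by
    rw [← add_div, div_le_iff₀ hN']
    have := sq_nonneg ‖h‖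
    nlinarith
  obtain ⟨a1, a2⟩ := abs_le.1 hA2
  rw [abs_le]
  constructor <;> linarith

/-- At density points, the set is dense at small scales. -/
lemma ja_density [FiniteDimensional ℝ E] [MeasurableSpace E] [BorelSpace E]
    (μ : Measure E) [μ.IsAddHaarMeasure] (K : Set E) (x : E)
    (h : Tendsto (fun r => μ (K ∩ closedBall x r) / μ (closedBall x r)) (𝓝[>] 0) (𝓝 1))
    {η : ℝ} (hη : 0 < η) :
    ∃ δ > 0, ∀ z, z ≠ x → ‖z - x‖ ≤ δ → ∃ y ∈ K, ‖y - z‖ ≤ η * ‖z - x‖ := by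
  have hcomp : IsCompact (closedBall (0:E) 1) := isCompact_closedBall _ _
  obtain ⟨t, -, htf, htc⟩ := hcomp.finite_cover_balls (e := η / 2) (by positivity)
  have hev : ∀ᶠ r in 𝓝[>] (0:ℝ), ∀ u ∈ t, (K ∩ ({x} + r • ball u (η / 2))).Nonempty := by
    rw [Filter.eventually_all_finite htf]
    intro u _
    exact Measure.eventually_nonempty_inter_smul_of_density_one μ K x h _ measurableSet_ball
      (measure_ball_pos μ _ (by positivity)).ne'
  rw [eventually_nhdsWithin_iff] at hev
  obtain ⟨δ, hδ, hball⟩ := Metric.eventually_nhds_iff.1 hev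
  refine ⟨δ / 2, by positivity, fun z hz hzx => ?_⟩
  have hr : 0 < ‖z - x‖ := norm_pos_iff.2 (sub_ne_zero.2 hz)
  set r := ‖z - x‖ with hrdef
  have h1 := hball (y := r) (by rw [Real.dist_eq, sub_zero, abs_of_pos hr]; linarith) hr
  have hu : (r⁻¹ • (z - x)) ∈ closedBall (0:E) 1 := by
    rw [mem_closedBall_zero_iff, norm_smul, norm_inv, Real.norm_of_nonneg hr.le, ← hrdef,
      inv_mul_cancel₀ hr.ne']
  obtain ⟨u, hu1, hu2⟩ := Set.mem_iUnion₂.1 (htc hu)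
  obtain ⟨y, hyK, hy⟩ := h1 u hu1
  refine ⟨y, hyK, ?_⟩
  rw [Set.singleton_add, Set.mem_image] at hy
  obtain ⟨b, hb, rfl⟩ := hy
  obtain ⟨c, hc, rfl⟩ := hb
  rw [mem_ball, dist_eq_norm] at hc hu2
  have e : x + r • c - z = r • ((c - u) - (r⁻¹ • (z - x) - u)) := by
    rw [sub_sub_sub_cancel_right, smul_sub, smul_smul, mul_inv_cancel₀ hr.ne', one_smul]
    abel
  show ‖x + r • c - z‖ ≤ _
  rw [e, norm_smul, Real.norm_of_nonneg hr.le, mul_comm]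
  apply mul_le_mul_of_nonneg_right _ hr.le
  exact (norm_sub_le _ _).trans (by linarith)

/-- First order expansion of slopes at density points where the slope is differentiable. -/
lemma ja_slope_diff [FiniteDimensional ℝ E] [MeasurableSpace E] [BorelSpace E]
    (μ : Measure E) [μ.IsAddHaarMeasure] {f : E → ℝ} {q : E → (E →L[ℝ] ℝ)} {x : E} {C d : ℝ}
    {Kb K : Set E} {A : E →L[ℝ] (E →L[ℝ] ℝ)} (hd : 0 < d) (hC : 0 ≤ C)
    (hx : closedBall x d ⊆ Kb) (hKKb : K ⊆ Kb)
    (hl : ∀ z ∈ Kb, ∀ y ∈ Kb, f z + q z (y - z) - C * ‖y - z‖ ^ 2 ≤ f y)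
    (hu : ∀ y ∈ K, ∀ z ∈ Kb, f z ≤ f y + q y (z - y) + C * ‖z - y‖ ^ 2)
    (h : Tendsto (fun r => μ (K ∩ closedBall x r) / μ (closedBall x r)) (𝓝[>] 0) (𝓝 1))
    (hA : HasFDerivWithinAt q A K x) :
    ∀ ε > 0, ∃ δ > 0, ∀ z, ‖z - x‖ ≤ δ → ‖q z - q x - A (z - x)‖ ≤ ε * ‖z - x‖ := by
  intro ε hε
  set η := min 1 (ε / (6 * C + 2 + ‖A‖)) with hηdef
  have hη : 0 < η := lt_min one_pos (by positivity)
  have hη1 : η ≤ 1 := min_le_left _ _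
  have hη2 : η * (6 * C + 2 + ‖A‖) ≤ ε := by
    have : η ≤ ε / (6 * C + 2 + ‖A‖) := min_le_right _ _
    rwa [le_div_iff₀ (by positivity)] at this
  obtain ⟨δ1, hδ1, H1⟩ := ja_density μ K x h hη
  have H2 := hA.isLittleO.def hη
  rw [eventually_nhdsWithin_iff] at H2
  obtain ⟨δ2, hδ2, H2⟩ := Metric.eventually_nhds_iff.1 H2
  refine ⟨min δ1 (min (δ2 / 4) (d / 2)), by positivity, fun z hz => ?_⟩
  have hz1 : ‖z - x‖ ≤ δ1 := hz.trans (min_le_left _ _)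
  have hz2 : ‖z - x‖ ≤ δ2 / 4 := hz.trans ((min_le_right _ _).trans (min_le_left _ _))
  have hz3 : ‖z - x‖ ≤ d / 2 := hz.trans ((min_le_right _ _).trans (min_le_right _ _))
  by_cases hzx : z = x
  · simp [hzx]
  have hr : 0 < ‖z - x‖ := norm_pos_iff.2 (sub_ne_zero.2 hzx)
  obtain ⟨y, hyK, hy⟩ := H1 z hzx hz1
  set r := ‖z - x‖ with hrdef
  have hyx : ‖y - x‖ ≤ 2 * r := by
    have : y - x = (y - z) + (z - x) := by abel
    rw [this]
    refine (norm_add_le _ _).trans ?_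
    nlinarith
  have hηr : η * r ≤ r := mul_le_of_le_one_left hr.le hη1
  have hzK : closedBall z (η * r) ⊆ Kb := by
    refine Set.Subset.trans (closedBall_subset_closedBall' ?_) hx
    rw [dist_eq_norm]
    linarith
  have s1 := ja_slope (q := q) (f := f) (x := z) (y := y) hC (mul_pos hη hr)
    (by rw [norm_sub_rev]; exact hy) hzK (hl z (hzK (by simp [mul_pos hη hr |>.le]))) (hl y (hKKb hyK))
    (hu y hyK)
  have s2 := H2 (y := y) (by rw [dist_eq_norm]; linarith) hyK
  have s3 : ‖A (y - z)‖ ≤ ‖A‖ * (η * r) :=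
    (A.le_opNorm _).trans (by gcongr)
  have e : q z - q x - A (z - x) = (q z - q y) + (q y - q x - A (y - x)) + A (y - z) := by
    simp only [map_sub]; abel
  rw [e]
  refine (norm_add₃_le).trans ?_
  have s4 : η * ‖y - x‖ ≤ η * (2 * r) := by gcongr
  have s5 := mul_le_mul_of_nonneg_right hη2 hr.le
  nlinarith

/-- Combined Jensen lemma and Alexandrov theorem. -/
theorem jensen_alexandrov [FiniteDimensional ℝ E]
    {f g : E → ℝ} {q r : E → (E →L[ℝ] ℝ)} {C Q d ρ : ℝ}
    {Kb D : Set E} (hd : 0 < d) (hC : 0 ≤ C) (hρ : 0 < ρ)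
    (hD : ∀ x ∈ D, closedBall x d ⊆ Kb)
    (hf : ∀ z ∈ Kb, ∀ y ∈ Kb, f z + q z (y - z) - C * ‖y - z‖ ^ 2 ≤ f y)
    (hg : ∀ z ∈ Kb, ∀ y ∈ Kb, g z + r z (y - z) - C * ‖y - z‖ ^ 2 ≤ g y)
    (hqQ : ∀ z ∈ Kb, ‖q z‖ ≤ Q) (hrQ : ∀ z ∈ Kb, ‖r z‖ ≤ Q)
    (hmax : ∀ p : E →L[ℝ] ℝ, ‖p‖ ≤ ρ → ∃ x ∈ D, ∀ y ∈ Kb, f y + g y - p y ≤ f x + g x - p x) :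
    ∃ x ∈ D, ∃ A B : E →L[ℝ] (E →L[ℝ] ℝ), ‖q x + r x‖ ≤ ρ ∧ (∀ h, A h h + B h h ≤ 0) ∧
      (∀ ε > 0, ∃ δ > 0, ∀ h, ‖h‖ ≤ δ → f (x + h) ≤ f x + q x h + 1 / 2 * A h h + ε * ‖h‖ ^ 2) ∧
      (∀ ε > 0, ∃ δ > 0, ∀ h, ‖h‖ ≤ δ → g (x + h) ≤ g x + r x h + 1 / 2 * B h h + ε * ‖h‖ ^ 2) := by
  classical
  let _ : MeasurableSpace E := borel E
  have : BorelSpace E := ⟨rfl⟩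
  let _ : MeasurableSpace (E →L[ℝ] ℝ) := borel _
  have : BorelSpace (E →L[ℝ] ℝ) := ⟨rfl⟩
  set K : Set E := {x | x ∈ D ∧ ∃ p : E →L[ℝ] ℝ, ‖p‖ ≤ ρ ∧
    ∀ y ∈ Kb, f y + g y - p y ≤ f x + g x - p x} with hK
  have hDKb : D ⊆ Kb := fun x hx => hD x hx (by simp [hd.le])
  have hKD : K ⊆ D := fun x hx => hx.1
  have hKKb : K ⊆ Kb := hKD.trans hDKb
  -- the slope of the contact functional
  have hslope : ∀ x ∈ D, ∀ p : E →L[ℝ] ℝ, (∀ y ∈ Kb, f y + g y - p y ≤ f x + g x - p x) →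
      q x + r x = p := by
    intro x hx p hp
    rw [← sub_eq_zero]
    refine ja_eq_zero (C := 2 * C) hd fun h hh => ?_
    have hm : x + h ∈ Kb := hD x hx (by simpa using hh)
    have h1 := hp _ hm
    have h2 := hf x (hDKb hx) _ hm
    have h3 := hg x (hDKb hx) _ hm
    rw [add_sub_cancel_left] at h2 h3
    rw [map_add] at h1
    simp only [_root_.sub_apply, _root_.add_apply]
    linarith
  have hK' : ∀ x ∈ K, ‖q x + r x‖ ≤ ρ ∧
      ∀ y ∈ Kb, f y + g y - (q x + r x) y ≤ f x + g x - (q x + r x) x := by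
    rintro x ⟨hx, p, hp, hm⟩
    rw [hslope x hx p hm]
    exact ⟨hp, hm⟩
  have huf : ∀ y ∈ K, ∀ z ∈ Kb, f z ≤ f y + q y (z - y) + C * ‖z - y‖ ^ 2 := by
    intro y hy z hz
    have h1 := (hK' y hy).2 z hz
    have h2 := hg y (hKKb hy) z hz
    simp only [_root_.add_apply, map_sub] at h1 h2 ⊢
    linarith
  have hug : ∀ y ∈ K, ∀ z ∈ Kb, g z ≤ g y + r y (z - y) + C * ‖z - y‖ ^ 2 := by
    intro y hy z hz
    have h1 := (hK' y hy).2 z hz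
    have h2 := hf y (hKKb hy) z hz
    simp only [_root_.add_apply, map_sub] at h1 h2 ⊢
    linarith
  -- Lipschitz
  have hLip : ∀ (F : E → ℝ) (s : E → (E →L[ℝ] ℝ)),
      (∀ z ∈ Kb, ∀ y ∈ Kb, F z + s z (y - z) - C * ‖y - z‖ ^ 2 ≤ F y) →
      (∀ z ∈ Kb, ‖s z‖ ≤ Q) →
      (∀ y ∈ K, ∀ z ∈ Kb, F z ≤ F y + s y (z - y) + C * ‖z - y‖ ^ 2) →
      LipschitzOnWith (Real.toNNReal (6 * C + 2 * |Q| / d)) s K := by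
    intro F s hF hs hU
    refine LipschitzOnWith.of_dist_le_mul fun x hx y hy => ?_
    rw [Real.coe_toNNReal _ (by positivity), dist_eq_norm, dist_eq_norm]
    by_cases hxy : x = y
    · simp [hxy]
    have hpos : 0 < ‖x - y‖ := norm_pos_iff.2 (sub_ne_zero.2 hxy)
    by_cases hle : ‖x - y‖ ≤ d
    · have := ja_slope (q := s) (f := F) hC hpos le_rfl
        ((closedBall_subset_closedBall hle).trans (hD x (hKD hx))) (hF x (hKKb hx))
        (hF y (hKKb hy)) (hU y hy)
      refine this.trans ?_
      gcongr
      have : 0 ≤ 2 * |Q| / d := by positivity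
      linarith
    · push Not at hle
      have h1 : ‖s x - s y‖ ≤ 2 * |Q| := by
        refine (norm_sub_le _ _).trans ?_
        have := hs x (hKKb hx)
        have := hs y (hKKb hy)
        have := le_abs_self Q
        linarith
      refine h1.trans ?_
      have h2 : 2 * |Q| = 2 * |Q| / d * d := by field_simp
      have h3 : 2 * |Q| / d * d ≤ 2 * |Q| / d * ‖x - y‖ := by gcongr
      have h4 : 0 ≤ 6 * C * ‖x - y‖ := by positivity
      rw [add_mul]
      linarith
  have hLf := hLip f q hf hqQ huf
  have hLg := hLip g r hg hrQ hug
  -- measure of `K`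
  set N : ℝ := ((Module.finrank ℝ E : ℕ) : ℝ) with hN
  have hμK : (Measure.hausdorffMeasure N : Measure E) K ≠ 0 := by
    intro h0
    have hG : LipschitzOnWith _ (fun x => q x + r x) K := hLf.add hLg
    have h1 := hG.hausdorffMeasure_image_le (d := N) (by positivity)
    rw [h0, mul_zero] at h1
    have h2 : closedBall (0 : E →L[ℝ] ℝ) ρ ⊆ (fun x => q x + r x) '' K := by
      intro p hp
      rw [mem_closedBall_zero_iff] at hp
      obtain ⟨x, hx, hm⟩ := hmax p hp
      exact ⟨x, ⟨hx, p, hp, hm⟩, hslope x hx p hm⟩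
    have h3 : (Measure.hausdorffMeasure N : Measure (E →L[ℝ] ℝ)) (closedBall 0 ρ) = 0 :=
      le_antisymm ((measure_mono h2).trans h1) bot_le
    have hfin : Module.finrank ℝ (E →L[ℝ] ℝ) = Module.finrank ℝ E := by
      rw [← (LinearMap.toContinuousLinearMap (𝕜 := ℝ) (E := E) (F' := ℝ)).finrank_eq]
      exact Subspace.dual_finrank_eq
    have h4 : 0 < (Measure.hausdorffMeasure N : Measure (E →L[ℝ] ℝ)) (closedBall 0 ρ) := by
      rw [hN, ← hfin]
      exact measure_closedBall_pos _ _ hρ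
    exact h4.ne' h3
  set μ : Measure E := Measure.hausdorffMeasure N with hμ
  haveI : μ.IsAddHaarMeasure := isAddHaarMeasure_hausdorffMeasure
  have a1 := hLf.ae_differentiableWithinAt_of_mem (μ := μ)
  have a2 := hLg.ae_differentiableWithinAt_of_mem (μ := μ)
  have a3 := ae_imp_of_ae_restrict (Besicovitch.ae_tendsto_measure_inter_div μ K)
  have hex : ∃ x ∈ K, DifferentiableWithinAt ℝ q K x ∧ DifferentiableWithinAt ℝ r K x ∧
      Tendsto (fun ρ => μ (K ∩ closedBall x ρ) / μ (closedBall x ρ)) (𝓝[>] 0) (𝓝 1) := by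
    by_contra hcon
    push Not at hcon
    apply hμK
    have : ∀ᵐ x ∂μ, x ∉ K := by
      filter_upwards [a1, a2, a3] with x b1 b2 b3 hx
      exact hcon x hx (b1 hx) (b2 hx) (b3 hx)
    rw [ae_iff] at this
    simpa using this
  obtain ⟨x, hxK, hqd, hrd, hden⟩ := hex
  have hxD := hKD hxK
  have Sq := ja_slope_diff μ hd hC (hD x hxD) hKKb hf huf hden hqd.hasFDerivWithinAt
  have Sr := ja_slope_diff μ hd hC (hD x hxD) hKKb hg hug hden hrd.hasFDerivWithinAt
  set A := fderivWithin ℝ q K x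
  set B := fderivWithin ℝ r K x
  have Ef := fun ε (hε : ε > 0) => ja_expand hd hC (hD x hxD) hf Sq hε
  have Eg := fun ε (hε : ε > 0) => ja_expand hd hC (hD x hxD) hg Sr hε
  refine ⟨x, hxD, A, B, (hK' x hxK).1, ?_, ?_, ?_⟩
  · intro h
    by_contra hcon
    push Not at hcon
    set κ := A h h + B h h with hκ
    have hε : 0 < κ / (8 * (‖h‖ ^ 2 + 1)) := by positivity
    obtain ⟨δ1, hδ1, hδ1d, H1⟩ := Ef _ hε
    obtain ⟨δ2, hδ2, -, H2⟩ := Eg _ hε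
    set t := min δ1 δ2 / (‖h‖ + 1) with ht
    have htp : 0 < t := by positivity
    have hth : ‖t • h‖ ≤ min δ1 δ2 := by
      rw [norm_smul, Real.norm_of_nonneg htp.le, ht, div_mul_eq_mul_div, div_le_iff₀ (by positivity)]
      have : 0 < min δ1 δ2 := lt_min hδ1 hδ2
      nlinarith
    have h1 := H1 _ (hth.trans (min_le_left _ _))
    have h2 := H2 _ (hth.trans (min_le_right _ _))
    have h3 := (hK' x hxK).2 (x + t • h) (hD x hxD (by
      rw [mem_closedBall, dist_eq_norm, add_sub_cancel_left]
      exact (hth.trans (min_le_left _ _)).trans hδ1d))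
    have h1' := (abs_le.1 h1).1
    have h2' := (abs_le.1 h2).1
    simp only [map_add, map_smul, _root_.add_apply, _root_.smul_apply,
      smul_eq_mul] at h1' h2' h3
    have e : κ / (8 * (‖h‖ ^ 2 + 1)) * ‖t • h‖ ^ 2 ≤ κ / 8 * t ^ 2 := by
      rw [norm_smul, Real.norm_of_nonneg htp.le, div_mul_eq_mul_div, div_le_iff₀ (by positivity)]
      have : 0 ≤ κ * t ^ 2 := by positivity
      nlinarith [sq_nonneg ‖h‖]
    have h5 : 1 / 2 * (t * (t * κ)) ≤ κ / 8 * t ^ 2 + κ / 8 * t ^ 2 := by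
      rw [hκ] at e ⊢
      linarith
    have : 0 < κ * t ^ 2 := by positivity
    nlinarith
  · intro ε hε
    obtain ⟨δ, hδ, -, H⟩ := Ef ε hε
    refine ⟨δ, hδ, fun h hh => ?_⟩
    have := (abs_le.1 (H h hh)).2
    linarith
  · intro ε hε
    obtain ⟨δ, hδ, -, H⟩ := Eg ε hε
    refine ⟨δ, hδ, fun h hh => ?_⟩
    have := (abs_le.1 (H h hh)).2
    linarith

end JensenAlexandrov

section Coordinates

variable {n : ℕ}

/-- Horizontal coordinates. -/
def ZL (n : ℕ) : Heis n →L[ℝ] (HIdx n → ℝ) :=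
  LinearMap.toContinuousLinearMap
    { toFun := fun ξ => Sum.elim ξ.1 ξ.2.1
      map_add' := by intro x y; ext i; cases i <;> simp
      map_smul' := by intro x y; ext i; cases i <;> simp }

/-- Vertical coordinate. -/
def TL (n : ℕ) : Heis n →L[ℝ] ℝ :=
  LinearMap.toContinuousLinearMap
    { toFun := fun ξ => ξ.2.2
      map_add' := by intro x y; simp
      map_smul' := by intro x y; simp }

/-- The linear map `ζ ↦ ξ ∘ ζ - ξ`. -/
def linH (η : Heis n) : Heis n →L[ℝ] Heis n :=
  LinearMap.toContinuousLinearMap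
    { toFun := fun h => (h.1, h.2.1, h.2.2 + 2 * (ZL n h ⬝ᵥ (Jmat n *ᵥ ZL n η)))
      map_add' := by
        intro x y
        ext i
        · simp
        · simp
        · simp only [map_add, add_dotProduct, Prod.snd_add]; ring
      map_smul' := by
        intro x y
        ext i
        · simp
        · simp
        · simp only [map_smul, smul_dotProduct, Prod.smul_snd, smul_eq_mul, RingHom.id_apply]; ring }

lemma ZL_apply (ξ : Heis n) : ZL n ξ = Sum.elim ξ.1 ξ.2.1 := rfl
lemma TL_apply (ξ : Heis n) : TL n ξ = ξ.2.2 := rfl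
lemma linH_apply (η h : Heis n) :
    linH η h = (h.1, h.2.1, h.2.2 + 2 * (ZL n h ⬝ᵥ (Jmat n *ᵥ ZL n η))) := rfl

lemma ZL_linH (η h : Heis n) : ZL n (linH η h) = ZL n h := rfl
lemma TL_linH (η h : Heis n) :
    TL n (linH η h) = TL n h + 2 * (ZL n h ⬝ᵥ (Jmat n *ᵥ ZL n η)) := rfl

lemma heis_ext {ξ η : Heis n} (h1 : ZL n ξ = ZL n η) (h2 : TL n ξ = TL n η) : ξ = η := by
  have a : ∀ i, ξ.1 i = η.1 i := fun i => congrFun h1 (Sum.inl i)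
  have b : ∀ i, ξ.2.1 i = η.2.1 i := fun i => congrFun h1 (Sum.inr i)
  exact Prod.ext (funext a) (Prod.ext (funext b) h2)

lemma J_inl (z : HIdx n → ℝ) (i : Fin n) : (Jmat n *ᵥ z) (Sum.inl i) = z (Sum.inr i) := by
  simp [Matrix.mulVec, dotProduct, Jmat]

lemma J_inr (z : HIdx n → ℝ) (i : Fin n) : (Jmat n *ᵥ z) (Sum.inr i) = - z (Sum.inl i) := by
  simp [Matrix.mulVec, dotProduct, Jmat]

lemma J_antisymm (i j : HIdx n) : Jmat n i j = - Jmat n j i := by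
  rcases i with i | i <;> rcases j with j | j <;> simp [Jmat, eq_comm] <;> split_ifs <;> simp

lemma dot_J (z z' : HIdx n → ℝ) : z ⬝ᵥ (Jmat n *ᵥ z') = - (z' ⬝ᵥ (Jmat n *ᵥ z)) := by
  simp only [dotProduct, Fintype.sum_sum_type, J_inl, J_inr]
  rw [← sub_eq_zero]
  simp only [← Finset.sum_neg_distrib, ← Finset.sum_add_distrib, neg_add, ← Finset.sum_sub_distrib]
  apply Finset.sum_eq_zero
  intro i _
  ring

lemma dot_J_self (z : HIdx n → ℝ) : z ⬝ᵥ (Jmat n *ᵥ z) = 0 := by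
  have := dot_J z z
  linarith

lemma J_dot_J (z : HIdx n → ℝ) : (Jmat n *ᵥ z) ⬝ᵥ (Jmat n *ᵥ z) = z ⬝ᵥ z := by
  simp only [dotProduct, Fintype.sum_sum_type, J_inl, J_inr]
  rw [add_comm]
  congr 1
  apply Finset.sum_congr rfl
  intro i _
  ring

lemma linH_neg_linH (ξ h : Heis n) : linH (-ξ) (linH ξ h) = h := by
  apply heis_ext
  · rfl
  · rw [TL_linH, TL_linH, ZL_linH, map_neg, Matrix.mulVec_neg, dotProduct_neg]; ring

lemma linH_linH_neg (ξ h : Heis n) : linH ξ (linH (-ξ) h) = h := by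
  apply heis_ext
  · rfl
  · rw [TL_linH, TL_linH, ZL_linH, map_neg, Matrix.mulVec_neg, dotProduct_neg]; ring

/-- Right-invariance of `ξ ∘ η⁻¹ = linH η (ξ - η)` under `(ξ, η) ↦ (ξ ∘ ζ, η ∘ ζ)`. -/
lemma linH_translate (ξ η ζ : Heis n) :
    linH (η + linH η ζ) (ξ + linH ξ ζ - (η + linH η ζ)) = linH η (ξ - η) := by
  apply heis_ext
  · simp only [ZL_linH, map_sub, map_add]; abel
  · simp only [TL_linH, map_sub, map_add, ZL_linH, Matrix.mulVec_add, dotProduct_add,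
      sub_dotProduct, add_dotProduct, Matrix.mulVec_sub, dotProduct_sub]
    have a1 := dot_J (ZL n ξ) (ZL n ζ)
    have a2 := dot_J (ZL n η) (ZL n ζ)
    have a3 := dot_J_self (ZL n ζ)
    have a4 := dot_J_self (ZL n η)
    linarith

lemma vec_Z (j : HIdx n) (η : Heis n) : ZL n (vecField j η) = Pi.single j 1 := by
  ext i
  rcases j with j | j <;> rcases i with i | i <;> simp [vecField, ZL_apply, Pi.single_apply]

lemma vec_T (j : HIdx n) (η : Heis n) : TL n (vecField j η) = 2 * (Jmat n *ᵥ ZL n η) j := by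
  rcases j with j | j <;> simp [vecField, ZL_apply, TL_apply, J_inl, J_inr]

lemma vec_linT (j : HIdx n) (η ξ : Heis n) :
    TL n (linH (-ξ) (vecField j η)) = 2 * (Jmat n *ᵥ ZL n (η - ξ)) j := by
  rw [TL_linH, vec_Z, vec_T, single_dotProduct, map_neg, map_sub, Matrix.mulVec_sub,
    Matrix.mulVec_neg]
  simp only [Pi.sub_apply, Pi.neg_apply]
  ring

/-- Derivative from an exact quadratic expansion. -/
lemma hasFDerivAt_of_quad {E : Type*} [NormedAddCommGroup E] [NormedSpace ℝ E] {φ : E → ℝ}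
    {η : E} {ℓ : E →L[ℝ] ℝ} {R : E → ℝ} {C : ℝ} (h : ∀ k, φ (η + k) = φ η + ℓ k + R k)
    (hR : ∀ k, |R k| ≤ C * ‖k‖ ^ 2) : HasFDerivAt φ ℓ η := by
  rw [hasFDerivAt_iff_isLittleO_nhds_zero]
  have : (fun k => φ (η + k) - φ η - ℓ k) = R := by
    ext k; rw [h]; ring
  rw [this]
  have h1 : R =O[𝓝 0] fun k => ‖k‖ ^ 2 := by
    refine IsBigO.of_bound C (Eventually.of_forall fun k => ?_)
    rw [Real.norm_eq_abs, Real.norm_of_nonneg (by positivity)]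
    exact hR k
  exact h1.trans_isLittleO (isLittleO_norm_pow_id one_lt_two)

/-- Continuous two-homogeneous functions have quadratic growth. -/
lemma hom2_bound {E : Type*} [NormedAddCommGroup E] [NormedSpace ℝ E] [FiniteDimensional ℝ E]
    {R : E → ℝ} (hc : Continuous R) (hh : ∀ (t : ℝ) x, R (t • x) = t ^ 2 * R x) :
    ∃ C, 0 ≤ C ∧ ∀ x, |R x| ≤ C * ‖x‖ ^ 2 := by
  obtain ⟨C, hC⟩ := (isCompact_closedBall (0:E) 1).exists_bound_of_continuousOn hc.continuousOn
  have hC0 : 0 ≤ C := (norm_nonneg _).trans (hC 0 (by simp))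
  refine ⟨C, hC0, fun x => ?_⟩
  by_cases hx : x = 0
  · have := hh 0 0
    simp at this
    simp [hx, this]
  have hx' : 0 < ‖x‖ := norm_pos_iff.2 hx
  have h1 := hC (‖x‖⁻¹ • x) (by
    rw [mem_closedBall_zero_iff, norm_smul, norm_inv, norm_norm, inv_mul_cancel₀ hx'.ne'])
  have h2 : R x = ‖x‖ ^ 2 * R (‖x‖⁻¹ • x) := by
    rw [← hh, smul_smul, mul_inv_cancel₀ hx'.ne', one_smul]
  rw [h2, abs_mul, abs_of_nonneg (by positivity), mul_comm]
  rw [Real.norm_eq_abs] at h1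
  gcongr

/-- Scalar product with a fixed vector as a continuous functional. -/
def dotL (w : HIdx n → ℝ) : (HIdx n → ℝ) →L[ℝ] ℝ :=
  LinearMap.toContinuousLinearMap
    { toFun := fun z => w ⬝ᵥ z
      map_add' := by intro x y; simp
      map_smul' := by intro x y; simp }

lemma dotL_apply (w z : HIdx n → ℝ) : dotL w z = w ⬝ᵥ z := rfl

lemma dot_symm_mul {A : HMat n} (hA : A.IsSymm) (x y : HIdx n → ℝ) :
    x ⬝ᵥ (A *ᵥ y) = (A *ᵥ x) ⬝ᵥ y := by
  rw [Matrix.dotProduct_mulVec, ← Matrix.mulVec_transpose, hA.eq]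

/-- The quadratic polynomial test function at the origin. -/
def qpoly (q : HIdx n → ℝ) (τ : ℝ) (A : HMat n) (M : ℝ) (ζ : Heis n) : ℝ :=
  q ⬝ᵥ ZL n ζ + τ * TL n ζ + 1 / 2 * (ZL n ζ ⬝ᵥ (A *ᵥ ZL n ζ)) + M * (TL n ζ) ^ 2

lemma contDiff_dot {E : Type*} [NormedAddCommGroup E] [NormedSpace ℝ E]
    {f g : E → (HIdx n → ℝ)} (hf : ContDiff ℝ 2 f) (hg : ContDiff ℝ 2 g) :
    ContDiff ℝ 2 (fun x => f x ⬝ᵥ g x) := by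
  unfold dotProduct
  apply ContDiff.sum
  intro i _
  exact (contDiff_pi.1 hf i).mul (contDiff_pi.1 hg i)

lemma contDiff_mulVec (A : HMat n) {E : Type*} [NormedAddCommGroup E] [NormedSpace ℝ E]
    {f : E → (HIdx n → ℝ)} (hf : ContDiff ℝ 2 f) :
    ContDiff ℝ 2 (fun x => A *ᵥ f x) := by
  rw [contDiff_pi]
  intro i
  exact contDiff_dot contDiff_const hf

lemma contDiff_qpoly (q : HIdx n → ℝ) (τ : ℝ) (A : HMat n) (M : ℝ) :
    ContDiff ℝ 2 (qpoly q τ A M) := by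
  unfold qpoly
  have hZ : ContDiff ℝ 2 (fun ζ : Heis n => ZL n ζ) := (ZL n).contDiff
  have hT : ContDiff ℝ 2 (fun ζ : Heis n => TL n ζ) := (TL n).contDiff
  exact (((contDiff_dot contDiff_const hZ).add (contDiff_const.mul hT)).add
    (contDiff_const.mul (contDiff_dot hZ (contDiff_mulVec A hZ)))).add
    (contDiff_const.mul (hT.pow 2))

/-- The test function at `ξ₀`. -/
def tfun (ξ₀ : Heis n) (u₀ : ℝ) (q : HIdx n → ℝ) (τ : ℝ) (A : HMat n) (M : ℝ) (ξ : Heis n) : ℝ :=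
  u₀ + qpoly q τ A M (linH (-ξ₀) (ξ - ξ₀))

lemma contDiff_tfun (ξ₀ : Heis n) (u₀ : ℝ) (q : HIdx n → ℝ) (τ : ℝ) (A : HMat n) (M : ℝ) :
    ContDiff ℝ 2 (tfun ξ₀ u₀ q τ A M) := by
  unfold tfun
  exact contDiff_const.add ((contDiff_qpoly q τ A M).comp
    ((linH (-ξ₀)).contDiff.comp (contDiff_id.sub contDiff_const)))

lemma tfun_self (ξ₀ : Heis n) (u₀ : ℝ) (q : HIdx n → ℝ) (τ : ℝ) (A : HMat n) (M : ℝ) :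
    tfun ξ₀ u₀ q τ A M ξ₀ = u₀ := by
  simp [tfun, qpoly]

lemma tfun_fderiv (ξ₀ : Heis n) (u₀ : ℝ) (q : HIdx n → ℝ) (τ : ℝ) {A : HMat n} (hA : A.IsSymm)
    (M : ℝ) (η : Heis n) (i : HIdx n) :
    fderiv ℝ (tfun ξ₀ u₀ q τ A M) η (vecField i η) =
      q i + (A *ᵥ ZL n (η - ξ₀)) i
        + (τ + 2 * M * TL n (linH (-ξ₀) (η - ξ₀))) * (2 * (Jmat n *ᵥ ZL n (η - ξ₀)) i) := by
  set s := TL n (linH (-ξ₀) (η - ξ₀)) with hs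
  set ℓ : Heis n →L[ℝ] ℝ := (dotL q).comp (ZL n) + (dotL (A *ᵥ ZL n (η - ξ₀))).comp (ZL n)
    + (τ + 2 * M * s) • (TL n).comp (linH (-ξ₀)) with hℓ
  set R : Heis n → ℝ := fun k => 1 / 2 * (ZL n k ⬝ᵥ (A *ᵥ ZL n k))
    + M * (TL n (linH (-ξ₀) k)) ^ 2 with hR
  have hRc : Continuous R := by
    have hZ : ContDiff ℝ 2 (fun ζ : Heis n => ZL n ζ) := (ZL n).contDiff
    exact (continuous_const.mul (contDiff_dot hZ (contDiff_mulVec A hZ)).continuous).add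
      (continuous_const.mul (((TL n).continuous.comp (linH (-ξ₀)).continuous).pow 2))
  have hRh : ∀ (t : ℝ) k, R (t • k) = t ^ 2 * R k := by
    intro t k
    simp only [hR, map_smul, Matrix.mulVec_smul, dotProduct_smul, smul_dotProduct, smul_eq_mul]
    ring
  obtain ⟨C, -, hC⟩ := hom2_bound hRc hRh
  have hd : HasFDerivAt (tfun ξ₀ u₀ q τ A M) ℓ η := by
    refine hasFDerivAt_of_quad (R := R) (fun k => ?_) hC
    have e : η + k - ξ₀ = (η - ξ₀) + k := by abel
    simp only [tfun, qpoly, hR, hℓ, e, ZL_linH, _root_.add_apply, ContinuousLinearMap.comp_apply,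
      dotL_apply, _root_.smul_apply, smul_eq_mul]
    rw [map_add (linH (-ξ₀)), map_add (TL n), ← hs, map_add (ZL n)]
    simp only [Matrix.mulVec_add, dotProduct_add, add_dotProduct]
    have := dot_symm_mul hA (ZL n (η - ξ₀)) (ZL n k)
    have h2 : ZL n k ⬝ᵥ (A *ᵥ ZL n (η - ξ₀)) = (A *ᵥ ZL n (η - ξ₀)) ⬝ᵥ ZL n k :=
      dotProduct_comm _ _
    rw [this, h2]
    ring
  rw [hd.fderiv]
  simp only [hℓ, _root_.add_apply, ContinuousLinearMap.comp_apply, dotL_apply,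
    _root_.smul_apply, smul_eq_mul, vec_Z, vec_linT, dotProduct_single, mul_one]

lemma tfun_hGrad (ξ₀ : Heis n) (u₀ : ℝ) (q : HIdx n → ℝ) (τ : ℝ) {A : HMat n} (hA : A.IsSymm)
    (M : ℝ) : hGrad (tfun ξ₀ u₀ q τ A M) ξ₀ = q := by
  ext i
  simp [hGrad, tfun_fderiv ξ₀ u₀ q τ hA M]

lemma tfun_hHess (ξ₀ : Heis n) (u₀ : ℝ) (q : HIdx n → ℝ) (τ : ℝ) {A : HMat n} (hA : A.IsSymm)
    (M : ℝ) (i j : HIdx n) :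
    hHess (tfun ξ₀ u₀ q τ A M) ξ₀ i j = A i j + 2 * τ * Jmat n i j := by
  simp only [hHess, Matrix.of_apply, tfun_fderiv ξ₀ u₀ q τ hA M]
  set ℓ : Heis n →L[ℝ] ℝ := (dotL (A i)).comp (ZL n) + (2 * τ) • (dotL (Jmat n i)).comp (ZL n)
    with hℓ
  set R : Heis n → ℝ := fun k => 4 * M * TL n (linH (-ξ₀) k) * (Jmat n i ⬝ᵥ ZL n k) with hR
  have hRc : Continuous R := by
    exact (continuous_const.mul ((TL n).continuous.comp (linH (-ξ₀)).continuous)).mul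
      ((dotL (Jmat n i)).continuous.comp (ZL n).continuous)
  have hRh : ∀ (t : ℝ) k, R (t • k) = t ^ 2 * R k := by
    intro t k
    simp only [hR, map_smul, dotProduct_smul, smul_eq_mul]
    ring
  obtain ⟨C, -, hC⟩ := hom2_bound hRc hRh
  have hd : HasFDerivAt (fun η : Heis n => q i + (A *ᵥ ZL n (η - ξ₀)) i
        + (τ + 2 * M * TL n (linH (-ξ₀) (η - ξ₀))) * (2 * (Jmat n *ᵥ ZL n (η - ξ₀)) i)) ℓ ξ₀ := by
    refine hasFDerivAt_of_quad (R := R) (fun k => ?_) hC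
    simp only [add_sub_cancel_left, sub_self, map_zero, Matrix.mulVec_zero, Pi.zero_apply, hℓ, hR,
      _root_.add_apply, ContinuousLinearMap.comp_apply, dotL_apply, _root_.smul_apply, smul_eq_mul]
    simp only [Matrix.mulVec]
    ring
  rw [hd.fderiv]
  simp only [hℓ, _root_.add_apply, ContinuousLinearMap.comp_apply, dotL_apply,
    _root_.smul_apply, smul_eq_mul, vec_Z, dotProduct_single, mul_one]

lemma tfun_hHessSym (ξ₀ : Heis n) (u₀ : ℝ) (q : HIdx n → ℝ) (τ : ℝ) {A : HMat n} (hA : A.IsSymm)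
    (M : ℝ) : hHessSym (tfun ξ₀ u₀ q τ A M) ξ₀ = A := by
  ext i j
  simp only [hHessSym, Matrix.smul_apply, Matrix.add_apply, Matrix.transpose_apply,
    tfun_hHess ξ₀ u₀ q τ hA M, smul_eq_mul]
  rw [J_antisymm j i, hA.apply i j]
  ring

/-- The quadratic term. -/
def Lq (a b c : ℝ) (p : HIdx n → ℝ) : HMat n :=
  a • vecMulVec p p - c • vecMulVec (Jmat n *ᵥ p) (Jmat n *ᵥ p)
      - (b * ∑ j, p j ^ 2) • (1 : HMat n)

lemma tfun_Fop (a b c : ℝ) (ξ₀ : Heis n) (u₀ : ℝ) (q : HIdx n → ℝ) (τ : ℝ) {A : HMat n}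
    (hA : A.IsSymm) (M : ℝ) :
    Fop (LquadC a b c) (tfun ξ₀ u₀ q τ A M) ξ₀ = A + Lq a b c q := by
  rw [Fop, tfun_hHessSym ξ₀ u₀ q τ hA M, tfun_hGrad ξ₀ u₀ q τ hA M]
  rfl

lemma tendsto_linH_neg (ξ₀ : Heis n) :
    Tendsto (fun ξ : Heis n => linH (-ξ₀) (ξ - ξ₀)) (𝓝 ξ₀) (𝓝 0) := by
  have : Continuous (fun ξ : Heis n => linH (-ξ₀) (ξ - ξ₀)) :=
    (linH (-ξ₀)).continuous.comp (continuous_id.sub continuous_const)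
  have h := this.tendsto ξ₀
  simpa using h

lemma sub_jet {a b c : ℝ} {Ω : Set (Heis n)} {S : Set (HMat n)} {v : Heis n → EReal}
    (hv : IsSubsolution Ω (LquadC a b c) S v) {ξ₀ : Heis n} (hξ : ξ₀ ∈ Ω) {u₀ : ℝ}
    (h0 : v ξ₀ = (u₀ : EReal)) {q : HIdx n → ℝ} {A : HMat n} (hA : A.IsSymm) {τ M : ℝ}
    (h : ∀ᶠ ζ in 𝓝 (0 : Heis n), ξ₀ + linH ξ₀ ζ ∈ Ω →
      v (ξ₀ + linH ξ₀ ζ) ≤ ((u₀ + qpoly q τ A M ζ : ℝ) : EReal)) :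
    A + Lq a b c q ∈ closure S := by
  have := hv ξ₀ hξ (tfun ξ₀ u₀ q τ A M) (contDiff_tfun ξ₀ u₀ q τ A M).contDiffOn
    (by rw [tfun_self, h0]) (by
      filter_upwards [(tendsto_linH_neg ξ₀).eventually h] with η hη
      rw [linH_linH_neg, add_sub_cancel] at hη
      exact hη)
  rwa [tfun_Fop a b c ξ₀ u₀ q τ hA M] at this

lemma super_jet {a b c : ℝ} {Ω : Set (Heis n)} {S : Set (HMat n)} {w : Heis n → EReal}
    (hw : IsSupersolution Ω (LquadC a b c) S w) {ξ₀ : Heis n} (hξ : ξ₀ ∈ Ω) {u₀ : ℝ}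
    (h0 : w ξ₀ = (u₀ : EReal)) {q : HIdx n → ℝ} {A : HMat n} (hA : A.IsSymm) {τ M : ℝ}
    (h : ∀ᶠ ζ in 𝓝 (0 : Heis n), ξ₀ + linH ξ₀ ζ ∈ Ω →
      ((u₀ + qpoly q τ A M ζ : ℝ) : EReal) ≤ w (ξ₀ + linH ξ₀ ζ)) :
    A + Lq a b c q ∉ S := by
  have := hw ξ₀ hξ (tfun ξ₀ u₀ q τ A M) (contDiff_tfun ξ₀ u₀ q τ A M).contDiffOn
    (by rw [tfun_self, h0]) (by
      filter_upwards [(tendsto_linH_neg ξ₀).eventually h] with η hη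
      rw [linH_linH_neg, add_sub_cancel] at hη
      exact hη)
  rwa [tfun_Fop a b c ξ₀ u₀ q τ hA M] at this

end Coordinates

section LinearAlgebra

variable {n : ℕ}

lemma dot_self_nonneg (x : HIdx n → ℝ) : 0 ≤ x ⬝ᵥ x :=
  Finset.sum_nonneg fun i _ => mul_self_nonneg (x i)

lemma dot_sq_le (x y : HIdx n → ℝ) : (x ⬝ᵥ y) ^ 2 ≤ (x ⬝ᵥ x) * (y ⬝ᵥ y) := by
  have := Finset.sum_mul_sq_le_sq_mul_sq Finset.univ x y
  simp only [dotProduct, ← pow_two] at *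
  exact this

lemma entry_quad_bound (D : HMat n) (ε : ℝ) (h : ∀ i j, |D i j| ≤ ε) (x : HIdx n → ℝ) :
    |x ⬝ᵥ (D *ᵥ x)| ≤ ε * (Fintype.card (HIdx n)) * (x ⬝ᵥ x) := by
  by_cases hne : Nonempty (HIdx n)
  · obtain ⟨i0⟩ := hne
    have hε : 0 ≤ ε := (abs_nonneg _).trans (h i0 i0)
    have h1 : |x ⬝ᵥ (D *ᵥ x)| ≤ ε * (∑ i, |x i|) ^ 2 := by
      have e : x ⬝ᵥ (D *ᵥ x) = ∑ i, ∑ j, x i * (D i j * x j) := by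
        simp only [dotProduct, Matrix.mulVec, Finset.mul_sum]
      rw [e, pow_two, Finset.sum_mul_sum, Finset.mul_sum]
      refine (Finset.abs_sum_le_sum_abs _ _).trans (Finset.sum_le_sum fun i _ => ?_)
      rw [Finset.mul_sum]
      refine (Finset.abs_sum_le_sum_abs _ _).trans (Finset.sum_le_sum fun j _ => ?_)
      rw [abs_mul, abs_mul]
      have := h i j
      calc |x i| * (|D i j| * |x j|) ≤ |x i| * (ε * |x j|) := by gcongr
        _ = ε * (|x i| * |x j|) := by ring
    have h2 := sq_sum_le_card_mul_sum_sq (s := Finset.univ) (f := fun i => |x i|)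
    have e2 : ∑ i, |x i| ^ 2 = x ⬝ᵥ x := by
      simp only [dotProduct, sq_abs, ← pow_two]
    rw [e2, Finset.card_univ] at h2
    calc _ ≤ _ := h1
      _ ≤ ε * (Fintype.card (HIdx n) * (x ⬝ᵥ x)) := by gcongr
      _ = _ := by ring
  · rw [not_nonempty_iff] at hne
    simp [dotProduct]

lemma symm_closure {S : Set (HMat n)} (hS : ∀ A ∈ S, A.IsSymm) {A : HMat n}
    (hA : A ∈ closure S) : A.IsSymm := by
  have hc : IsClosed {A : HMat n | A.IsSymm} := by
    have : {A : HMat n | A.IsSymm} = {A | Aᵀ = A} := rfl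
    rw [this]
    exact isClosed_eq (continuous_id.matrix_transpose) continuous_id
  exact closure_minimal (fun A hA => hS A hA) hc hA

lemma closure_add_mem {S : Set (HMat n)} (hSsymm : ∀ A ∈ S, A.IsSymm)
    (hSpos : ∀ A ∈ S, ∀ B : HMat n, B.PosDef → A + B ∈ S) {A B : HMat n} {κ : ℝ} (hκ : 0 < κ)
    (hA : A ∈ closure S) (hB : B.IsSymm) (hBκ : ∀ x, κ * (x ⬝ᵥ x) ≤ x ⬝ᵥ (B *ᵥ x)) :
    A + B ∈ S := by
  have hAs := symm_closure hSsymm hA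
  set N : ℝ := ((Fintype.card (HIdx n) : ℕ) : ℝ) with hN
  have hN0 : 0 ≤ N := by positivity
  set ε : ℝ := κ / (2 * (N + 1)) with hε
  have hε0 : 0 < ε := by positivity
  have hU : {A' : HMat n | ∀ i j, |A' i j - A i j| < ε} ∈ 𝓝 A := by
    apply IsOpen.mem_nhds
    · simp only [Set.setOf_forall]
      refine isOpen_iInter_of_finite fun i => isOpen_iInter_of_finite fun j => ?_
      exact isOpen_lt ((continuous_id.matrix_elem i j).sub continuous_const).abs continuous_const
    · intro i j; simpa using hε0
  obtain ⟨A', hA', hA'S⟩ := mem_closure_iff_nhds.1 hA _ hU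
  have hsymm : (B + (A - A')).IsSymm := hB.add (hAs.sub (hSsymm _ hA'S))
  have hpd : (B + (A - A')).PosDef := by
    refine Matrix.PosDef.of_dotProduct_mulVec_pos ?_ ?_
    · rw [Matrix.IsHermitian, Matrix.conjTranspose_eq_transpose_of_trivial]; exact hsymm
    · intro x hx
      have hx' : 0 < x ⬝ᵥ x := by
        refine lt_of_le_of_ne (dot_self_nonneg x) (Ne.symm ?_)
        rw [Ne, dotProduct_self_eq_zero]; exact hx
      have h1 := entry_quad_bound (A - A') ε (fun i j => by
        have := (hA' i j).le
        rw [abs_sub_comm] at this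
        simpa using this) x
      have h2 := (abs_le.1 h1).1
      have h3 := hBκ x
      rw [star_trivial, Matrix.add_mulVec, dotProduct_add]
      have h4 : ε * N < κ := by
        rw [hε, div_mul_eq_mul_div, div_lt_iff₀ (by positivity)]
        nlinarith
      rw [← hN] at h2
      nlinarith
  have := hSpos A' hA'S _ hpd
  have e : A' + (B + (A - A')) = A + B := by abel
  rwa [e] at this

lemma closure_smul_mem {S : Set (HMat n)}
    (hScone : ∀ A ∈ S, ∀ c : ℝ, 0 < c → c • A ∈ S) {A : HMat n} {c : ℝ} (hc : 0 < c)
    (hA : A ∈ closure S) : c • A ∈ closure S :=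
  map_mem_closure (continuous_const_smul c) hA (fun A hA => hScone A hA c hc)

lemma vecMulVec_isSymm (p : HIdx n → ℝ) : (vecMulVec p p).IsSymm := by
  ext i j; simp [vecMulVec_apply, mul_comm]

lemma Lq_isSymm (a b c : ℝ) (p : HIdx n → ℝ) : (Lq a b c p).IsSymm := by
  unfold Lq
  exact (((vecMulVec_isSymm p).smul a).sub ((vecMulVec_isSymm _).smul c)).sub
    (Matrix.isSymm_one.smul _)

lemma vecMulVec_quad (p x : HIdx n → ℝ) : x ⬝ᵥ (vecMulVec p p *ᵥ x) = (p ⬝ᵥ x) ^ 2 := by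
  rw [vecMulVec_mulVec, dotProduct_smul, dotProduct_comm x p]
  simp [pow_two]

lemma Lq_quad (a b c : ℝ) (p x : HIdx n → ℝ) :
    x ⬝ᵥ (Lq a b c p *ᵥ x) = a * (p ⬝ᵥ x) ^ 2 - c * ((Jmat n *ᵥ p) ⬝ᵥ x) ^ 2
      - b * (p ⬝ᵥ p) * (x ⬝ᵥ x) := by
  have e : ∑ j, p j ^ 2 = p ⬝ᵥ p := by simp only [dotProduct, pow_two]
  rw [Lq, e, Matrix.sub_mulVec, Matrix.sub_mulVec, Matrix.smul_mulVec, Matrix.smul_mulVec,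
    Matrix.smul_mulVec, dotProduct_sub, dotProduct_sub, dotProduct_smul, dotProduct_smul,
    dotProduct_smul, vecMulVec_quad, vecMulVec_quad, Matrix.one_mulVec]
  simp only [smul_eq_mul]

lemma Lq_smul (a b c t : ℝ) (p : HIdx n → ℝ) : Lq a b c (t • p) = t ^ 2 • Lq a b c p := by
  have e : ∑ j, (t • p) j ^ 2 = t ^ 2 * ∑ j, p j ^ 2 := by
    rw [Finset.mul_sum]; exact Finset.sum_congr rfl fun i _ => by simp [mul_pow]
  unfold Lq
  rw [e, Matrix.mulVec_smul]
  ext i j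
  simp [vecMulVec_apply]
  ring

lemma Lq_neg (a b c : ℝ) (p : HIdx n → ℝ) : Lq a b c (-p) = Lq a b c p := by
  have := Lq_smul a b c (-1) p
  simpa using this

/-- Continuity of the quadratic term. -/
lemma Lq_cont (a b c : ℝ) {K κ : ℝ} (hK : 0 ≤ K) (hκ : 0 < κ) :
    ∃ ρ > 0, ∀ q r : HIdx n → ℝ, q ⬝ᵥ q ≤ K → (q + r) ⬝ᵥ (q + r) ≤ ρ → ∀ x : HIdx n → ℝ,
      |x ⬝ᵥ (Lq a b c r *ᵥ x) - x ⬝ᵥ (Lq a b c q *ᵥ x)| ≤ κ * (x ⬝ᵥ x) := by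
  set C := |a| + |b| + |c| with hC
  have hC0 : 0 ≤ C := by positivity
  set θ := min 1 (κ / ((C + 1) * (K + 2))) with hθ
  have hθ0 : 0 < θ := lt_min one_pos (by positivity)
  have hθ1 : θ ≤ 1 := min_le_left _ _
  have hθ2 : C * ((K + 2) * θ) ≤ κ := by
    have : θ ≤ κ / ((C + 1) * (K + 2)) := min_le_right _ _
    rw [le_div_iff₀ (by positivity)] at this
    nlinarith [mul_nonneg (mul_nonneg hθ0.le hK) hC0, mul_nonneg hθ0.le hK]
  refine ⟨θ ^ 2, by positivity, fun q r hq hs x => ?_⟩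
  set s := q + r with hs'
  have hr : r = s - q := by rw [hs']; abel
  rw [hr, Lq_quad, Lq_quad]
  have key : ∀ u v E : ℝ, 0 ≤ E → u ^ 2 ≤ K * E → v ^ 2 ≤ θ ^ 2 * E →
      |(v - u) ^ 2 - u ^ 2| ≤ (K + 2) * θ * E := by
    intro u v E hE hu hv
    have h1 : θ * |2 * u * v| ≤ θ * ((K + 1) * θ * E) := by
      have : |2 * u * v| = 2 * |u| * |v| := by rw [abs_mul, abs_mul]; norm_num
      rw [this]
      have a1 : |u| ^ 2 = u ^ 2 := sq_abs u
      have a2 : |v| ^ 2 = v ^ 2 := sq_abs v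
      nlinarith [sq_nonneg (θ * |u| - |v|), mul_le_mul_of_nonneg_left hu (sq_nonneg θ)]
    have h2 := le_of_mul_le_mul_left h1 hθ0
    have h3 : v ^ 2 ≤ θ * E := hv.trans (by nlinarith)
    have h4 := abs_le.1 h2
    rw [abs_le]
    constructor <;> nlinarith [sq_nonneg v]
  have hE := dot_self_nonneg x
  have k1 := key (q ⬝ᵥ x) (s ⬝ᵥ x) (x ⬝ᵥ x) hE
    ((dot_sq_le q x).trans (by gcongr)) ((dot_sq_le s x).trans (by gcongr))
  have k2 := key ((Jmat n *ᵥ q) ⬝ᵥ x) ((Jmat n *ᵥ s) ⬝ᵥ x) (x ⬝ᵥ x) hE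
    ((dot_sq_le _ x).trans (by rw [J_dot_J]; gcongr))
    ((dot_sq_le _ x).trans (by rw [J_dot_J]; gcongr))
  have k3 : |(s - q) ⬝ᵥ (s - q) - q ⬝ᵥ q| ≤ (K + 2) * θ := by
    have e : (s - q) ⬝ᵥ (s - q) - q ⬝ᵥ q = s ⬝ᵥ s - 2 * (q ⬝ᵥ s) := by
      rw [sub_dotProduct, dotProduct_sub, dotProduct_sub, dotProduct_comm s q]; ring
    rw [e]
    have h1 := dot_sq_le q s
    have h2 : |q ⬝ᵥ s| ≤ (K + 1) / 2 * θ := by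
      apply abs_le_of_sq_le_sq _ (by positivity)
      have h3 : (q ⬝ᵥ q) * (s ⬝ᵥ s) ≤ K * θ ^ 2 :=
        mul_le_mul hq hs (dot_self_nonneg _) hK
      nlinarith [sq_nonneg (K - 1), sq_nonneg θ, mul_nonneg (sq_nonneg (K - 1)) (sq_nonneg θ)]
    have h4 := abs_le.1 h2
    have h5 := dot_self_nonneg s
    rw [abs_le]
    constructor <;> nlinarith
  rw [sub_dotProduct, Matrix.mulVec_sub, sub_dotProduct]
  rw [abs_le] at *
  have e1 : ∀ t y B : ℝ, -B ≤ y → y ≤ B → |t * y| ≤ |t| * B := by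
    intro t y B h1 h2
    rw [abs_mul]; exact mul_le_mul_of_nonneg_left (abs_le.2 ⟨h1, h2⟩) (abs_nonneg _)
  have f1 := abs_le.1 (e1 a _ _ k1.1 k1.2)
  have f2 := abs_le.1 (e1 c _ _ k2.1 k2.2)
  have f3 := abs_le.1 (e1 b _ _ k3.1 k3.2)
  have g1 := mul_le_mul_of_nonneg_right f3.1 hE
  have g2 := mul_le_mul_of_nonneg_right f3.2 hE
  have g3 := mul_le_mul_of_nonneg_right hθ2 hE
  rw [hC] at g3
  constructor <;> nlinarith

set_option maxHeartbeats 800000 in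
/-- The algebra behind the strictness transform. -/
lemma strict_alg {a b c σ d μ Λ g1 : ℝ} {q0 z0 : HIdx n → ℝ} (hσb : σ * b = |b|)
    (hσc : σ * c = |c|) (hσ : |σ| = 1) (hd : 0 < d) (hμ : 0 < μ)
    (hg1 : 0 < g1) (hg1' : g1 ≤ 3 / 2) (hg : g1 = 1 + σ * d) (hΛ : 3 * |a| + 3 ≤ Λ)
    (hsmall : 4 * μ * (1 / d + 1) * (|a| + |b| + |c|) * (z0 ⬝ᵥ z0) ≤ 1) (x : HIdx n → ℝ) :
    μ * (x ⬝ᵥ x) ≤ 2 * μ * (x ⬝ᵥ x) + Λ * d / g1 * (q0 ⬝ᵥ x) ^ 2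
      + x ⬝ᵥ (Lq a b c (q0 + (2 * μ) • z0) *ᵥ x) - g1 * (x ⬝ᵥ (Lq a b c q0 *ᵥ x)) := by
  rw [Lq_quad, Lq_quad]
  have hE := dot_self_nonneg x
  have e1 : (q0 + (2 * μ) • z0) ⬝ᵥ x = q0 ⬝ᵥ x + 2 * μ * (z0 ⬝ᵥ x) := by
    rw [add_dotProduct, smul_dotProduct, smul_eq_mul]
  have e2 : (Jmat n *ᵥ (q0 + (2 * μ) • z0)) ⬝ᵥ x
      = (Jmat n *ᵥ q0) ⬝ᵥ x + 2 * μ * ((Jmat n *ᵥ z0) ⬝ᵥ x) := by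
    rw [Matrix.mulVec_add, Matrix.mulVec_smul, add_dotProduct, smul_dotProduct, smul_eq_mul]
  have e3 : (q0 + (2 * μ) • z0) ⬝ᵥ (q0 + (2 * μ) • z0)
      = q0 ⬝ᵥ q0 + 4 * μ * (q0 ⬝ᵥ z0) + 4 * μ ^ 2 * (z0 ⬝ᵥ z0) := by
    simp only [add_dotProduct, dotProduct_add, smul_dotProduct, dotProduct_smul, smul_eq_mul]
    rw [dotProduct_comm z0 q0]; ring
  rw [e1, e2, e3]
  have c1 := dot_sq_le z0 x
  have c2 := dot_sq_le (Jmat n *ᵥ z0) x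
  rw [J_dot_J] at c2
  have c3 : |4 * μ * (q0 ⬝ᵥ z0)| ≤ d * (q0 ⬝ᵥ q0) + 4 * μ ^ 2 / d * (z0 ⬝ᵥ z0) := by
    have h1 := dot_self_nonneg (d • q0 + (2 * μ) • z0)
    have h2 := dot_self_nonneg (d • q0 - (2 * μ) • z0)
    simp only [add_dotProduct, dotProduct_add, smul_dotProduct, dotProduct_smul, smul_eq_mul,
      sub_dotProduct, dotProduct_sub] at h1 h2
    rw [dotProduct_comm z0 q0] at h1 h2
    have h3 : d * (d * (q0 ⬝ᵥ q0) + 4 * μ ^ 2 / d * (z0 ⬝ᵥ z0))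
        = d ^ 2 * (q0 ⬝ᵥ q0) + 4 * μ ^ 2 * (z0 ⬝ᵥ z0) := by field_simp
    rw [abs_le]
    constructor
    · refine le_of_mul_le_mul_left ?_ hd
      rw [mul_neg, h3]; nlinarith
    · refine le_of_mul_le_mul_left ?_ hd
      rw [h3]; nlinarith
  have amgm : ∀ u v : ℝ, |4 * μ * (u * v)| ≤ d * u ^ 2 + 4 * μ ^ 2 / d * v ^ 2 := by
    intro u v
    have h3 : d * (d * u ^ 2 + 4 * μ ^ 2 / d * v ^ 2)
        = d ^ 2 * u ^ 2 + 4 * μ ^ 2 * v ^ 2 := by field_simp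
    rw [abs_le]
    constructor
    · refine le_of_mul_le_mul_left ?_ hd
      rw [mul_neg, h3]; nlinarith [sq_nonneg (d * u + 2 * μ * v)]
    · refine le_of_mul_le_mul_left ?_ hd
      rw [h3]; nlinarith [sq_nonneg (d * u - 2 * μ * v)]
  have k1 := amgm (q0 ⬝ᵥ x) (z0 ⬝ᵥ x)
  have k2 := amgm ((Jmat n *ᵥ q0) ⬝ᵥ x) ((Jmat n *ᵥ z0) ⬝ᵥ x)
  generalize (q0 ⬝ᵥ x) = X at *
  generalize (z0 ⬝ᵥ x) = Z at *
  generalize (Jmat n *ᵥ q0) ⬝ᵥ x = Y at *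
  generalize (Jmat n *ᵥ z0) ⬝ᵥ x = W at *
  generalize (q0 ⬝ᵥ q0) = P at *
  generalize (q0 ⬝ᵥ z0) = D at *
  generalize (z0 ⬝ᵥ z0) = R at *
  generalize (x ⬝ᵥ x) = E at *
  have am : ∀ t y B : ℝ, |y| ≤ B → -(|t| * B) ≤ t * y := by
    intro t y B h
    have : |t * y| ≤ |t| * B := by
      rw [abs_mul]; exact mul_le_mul_of_nonneg_left h (abs_nonneg _)
    exact (abs_le.1 this).1
  have A1 := am a _ _ k1
  have A2 := am (-c) _ _ k2
  have A3 := mul_le_mul_of_nonneg_right (am (-b) _ _ c3) hE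
  rw [abs_neg] at A2 A3
  have B1 : -(|a| * (R * E)) ≤ a * Z ^ 2 := am a _ _ (by rwa [abs_of_nonneg (sq_nonneg _)])
  have B2 : -(|c| * (R * E)) ≤ -c * W ^ 2 := by
    have := am (-c) (W ^ 2) (R * E) (by rw [abs_of_nonneg (sq_nonneg _)]; exact c2)
    rwa [abs_neg] at this
  have hR : 0 ≤ R * E := le_trans (sq_nonneg _) c1
  have B3 : -(|b| * (R * E)) ≤ -b * (R * E) := by
    have := am (-b) (R * E) _ (by rw [abs_of_nonneg hR])
    rwa [abs_neg] at this
  have G1 : (2 * |a| + 2) * d * X ^ 2 ≤ Λ * d / g1 * X ^ 2 := by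
    apply mul_le_mul_of_nonneg_right _ (sq_nonneg _)
    rw [le_div_iff₀ hg1]
    have h1 : (2 * |a| + 2) * g1 ≤ Λ := by
      have : 0 ≤ |a| := abs_nonneg a
      have h0 := mul_le_mul_of_nonneg_left hg1' (show 0 ≤ 2 * |a| + 2 by positivity)
      linarith
    have h2 := mul_le_mul_of_nonneg_right h1 hd.le
    linarith
  have G2 : - (d * |a| * X ^ 2) ≤ - (σ * d * (a * X ^ 2)) := by
    have h1 : |σ * a| = |a| := by rw [abs_mul, hσ, one_mul]
    have h2 : σ * a ≤ |a| := h1 ▸ le_abs_self _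
    have h3 : 0 ≤ d * X ^ 2 := by positivity
    have h4 := mul_le_mul_of_nonneg_right h2 h3
    linarith
  have S1 := mul_le_mul_of_nonneg_left hsmall (mul_nonneg hμ.le hE)
  have C1 := mul_le_mul_of_nonneg_left c1 (show 0 ≤ |a| * (4 * μ ^ 2 / d) by positivity)
  have C2 := mul_le_mul_of_nonneg_left c2 (show 0 ≤ |c| * (4 * μ ^ 2 / d) by positivity)
  have M1 := mul_le_mul_of_nonneg_left B1 (show 0 ≤ 4 * μ ^ 2 by positivity)
  have M2 := mul_le_mul_of_nonneg_left B2 (show 0 ≤ 4 * μ ^ 2 by positivity)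
  have M3 := mul_le_mul_of_nonneg_left B3 (show 0 ≤ 4 * μ ^ 2 by positivity)
  have S2 : μ * E * (4 * μ * (1 / d + 1) * (|a| + |b| + |c|) * R) =
     (|a| + |b| + |c|) * (4 * μ ^ 2 / d) * (R * E) + (|a| + |b| + |c|) * (4 * μ ^ 2) * (R * E) := by
    field_simp
  rw [S2] at S1
  have hdX : 0 ≤ d * X ^ 2 := by positivity
  have T1 : σ * d * (c * Y ^ 2) = d * |c| * Y ^ 2 := by rw [← hσc]; ring
  have T2 : σ * d * (b * P * E) = d * |b| * P * E := by rw [← hσb]; ring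
  rw [hg] at *
  generalize 4 * μ ^ 2 / d = m at *
  generalize Λ * d / (1 + σ * d) = G at *
  generalize |a| = a' at *
  generalize |b| = b' at *
  generalize |c| = c' at *
  linarith

/-- From a jet of the transformed function to strictness. -/
lemma strict_mem {S : Set (HMat n)} (hSsymm : ∀ A ∈ S, A.IsSymm)
    (hSpos : ∀ A ∈ S, ∀ B : HMat n, B.PosDef → A + B ∈ S)
    (hScone : ∀ A ∈ S, ∀ c : ℝ, 0 < c → c • A ∈ S)
    {a b c σ d μ Λ g1 : ℝ} {q z0 : HIdx n → ℝ} {A : HMat n} (hσb : σ * b = |b|)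
    (hσc : σ * c = |c|) (hσ : |σ| = 1) (hd : 0 < d) (hμ : 0 < μ)
    (hg1 : 0 < g1) (hg1' : g1 ≤ 3 / 2) (hg : g1 = 1 + σ * d) (hΛ : 3 * |a| + 3 ≤ Λ)
    (hsmall : 4 * μ * (1 / d + 1) * (|a| + |b| + |c|) * (z0 ⬝ᵥ z0) ≤ 1) (hA : A.IsSymm)
    (hmem : g1 • (A - (2 * μ) • (1 : HMat n))
      + (-(Λ * d)) • vecMulVec (q - (2 * μ) • z0) (q - (2 * μ) • z0)
      + Lq a b c (g1 • (q - (2 * μ) • z0)) ∈ closure S) :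
    A + Lq a b c q - (μ / 2) • (1 : HMat n) ∈ closure S := by
  apply subset_closure
  set q0 := q - (2 * μ) • z0 with hq0
  have hq : q = q0 + (2 * μ) • z0 := by rw [hq0]; abel
  have h1 := closure_smul_mem hScone (inv_pos.2 hg1) hmem
  set M1 := g1⁻¹ • (g1 • (A - (2 * μ) • (1 : HMat n)) + (-(Λ * d)) • vecMulVec q0 q0
    + Lq a b c (g1 • q0)) with hM1
  have hM1' : M1 = (A - (2 * μ) • (1 : HMat n)) - (Λ * d / g1) • vecMulVec q0 q0
      + g1 • Lq a b c q0 := by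
    rw [hM1, Lq_smul, smul_add, smul_add, smul_smul, smul_smul, smul_smul, inv_mul_cancel₀ hg1.ne',
      one_smul]
    have e1 : g1⁻¹ * -(Λ * d) = - (Λ * d / g1) := by field_simp
    have e2 : g1⁻¹ * g1 ^ 2 = g1 := by field_simp
    rw [e1, e2, neg_smul, sub_eq_add_neg _ ((Λ * d / g1) • _)]
  have e : A + Lq a b c q - (μ / 2) • (1 : HMat n) = M1 +
      (A + Lq a b c q - (μ / 2) • (1 : HMat n) - M1) := by abel
  rw [e]
  have hM1s := symm_closure hSsymm h1
  refine closure_add_mem hSsymm hSpos (half_pos hμ) h1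
    (((hA.add (Lq_isSymm a b c q)).sub (Matrix.isSymm_one.smul _)).sub hM1s) fun x => ?_
  have h3 := strict_alg (q0 := q0) (z0 := z0) hσb hσc hσ hd hμ hg1 hg1' hg hΛ hsmall x
  rw [← hq] at h3
  rw [hM1']
  simp only [Matrix.sub_mulVec, Matrix.add_mulVec, Matrix.smul_mulVec, Matrix.one_mulVec,
    dotProduct_sub, dotProduct_add, dotProduct_smul, smul_eq_mul, vecMulVec_quad]
  linarith

end LinearAlgebra

section Transform

variable {n : ℕ}

lemma differentiable_Di (ξ₀ : Heis n) (u₀ : ℝ) (q : HIdx n → ℝ) (τ : ℝ) {A : HMat n}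
    (hA : A.IsSymm) (M : ℝ) (i : HIdx n) :
    Differentiable ℝ (fun η => fderiv ℝ (tfun ξ₀ u₀ q τ A M) η (vecField i η)) := by
  simp only [tfun_fderiv ξ₀ u₀ q τ hA M]
  have h1 : ∀ (B : HMat n), Differentiable ℝ (fun η : Heis n => (B *ᵥ ZL n (η - ξ₀)) i) := by
    intro B
    have : (fun η : Heis n => (B *ᵥ ZL n (η - ξ₀)) i)
        = fun η => dotL (B i) (ZL n (η - ξ₀)) := rfl
    rw [this]
    fun_prop
  have h2 := h1 A
  have h3 := h1 (Jmat n)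
  fun_prop

lemma comp_hGrad {g g1 : ℝ → ℝ} (hg : ∀ s, HasDerivAt g (g1 s) s) {ψ : Heis n → ℝ}
    (hψ : Differentiable ℝ ψ) (η : Heis n) (i : HIdx n) :
    fderiv ℝ (fun η => g (ψ η)) η (vecField i η) = g1 (ψ η) * fderiv ℝ ψ η (vecField i η) := by
  have : HasFDerivAt (fun η => g (ψ η)) (g1 (ψ η) • fderiv ℝ ψ η) η :=
    (hg (ψ η)).comp_hasFDerivAt η (hψ η).hasFDerivAt
  rw [this.fderiv]
  rfl

lemma comp_Fop (a b c : ℝ) {g g1 g2 : ℝ → ℝ} (hg : ∀ s, HasDerivAt g (g1 s) s)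
    (hg1 : ∀ s, HasDerivAt g1 (g2 s) s) (ξ₀ : Heis n) (u₀ : ℝ) (q : HIdx n → ℝ) (τ : ℝ)
    {A : HMat n} (hA : A.IsSymm) (M : ℝ) :
    Fop (LquadC a b c) (fun η => g (tfun ξ₀ u₀ q τ A M η)) ξ₀
      = g1 u₀ • A + g2 u₀ • vecMulVec q q + Lq a b c (g1 u₀ • q) := by
  set ψ := tfun ξ₀ u₀ q τ A M with hψ
  have hd : Differentiable ℝ ψ :=
    (contDiff_tfun ξ₀ u₀ q τ A M).differentiable (by norm_num)
  have hψ0 : ψ ξ₀ = u₀ := tfun_self ξ₀ u₀ q τ A M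
  have hG : hGrad ψ ξ₀ = q := tfun_hGrad ξ₀ u₀ q τ hA M
  have hgrad : hGrad (fun η => g (ψ η)) ξ₀ = g1 u₀ • q := by
    ext i
    rw [hGrad, comp_hGrad hg hd, hψ0, ← hG]
    rfl
  have hhess : ∀ i j, hHess (fun η => g (ψ η)) ξ₀ i j
      = g1 u₀ * (A i j + 2 * τ * Jmat n i j) + g2 u₀ * (q i * q j) := by
    intro i j
    rw [← tfun_hHess ξ₀ u₀ q τ hA M i j]
    simp only [hHess, Matrix.of_apply, comp_hGrad hg hd]
    have e1 : HasFDerivAt (fun η => g1 (ψ η)) (g2 (ψ ξ₀) • fderiv ℝ ψ ξ₀) ξ₀ :=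
      (hg1 (ψ ξ₀)).comp_hasFDerivAt ξ₀ (hd ξ₀).hasFDerivAt
    have e2 := (differentiable_Di ξ₀ u₀ q τ hA M i ξ₀).hasFDerivAt
    have e4 : HasFDerivAt (fun η => g1 (ψ η) * fderiv ℝ ψ η (vecField i η)) _ ξ₀ := e1.mul e2
    rw [e4.fderiv]
    have e3 : ∀ k, fderiv ℝ ψ ξ₀ (vecField k ξ₀) = q k := fun k => congrFun hG k
    simp only [_root_.add_apply, _root_.smul_apply, smul_eq_mul, ← hψ, e3, hψ0]
    ring
  rw [Fop, hgrad, hHessSym]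
  congr 1
  ext i j
  simp only [Matrix.smul_apply, Matrix.add_apply, Matrix.transpose_apply, hhess, smul_eq_mul,
    vecMulVec_apply]
  rw [J_antisymm j i, hA.apply i j]
  ring

lemma sub_jet_comp {a b c : ℝ} {Ω : Set (Heis n)} {S : Set (HMat n)} {v : Heis n → EReal}
    (hv : IsSubsolution Ω (LquadC a b c) S v) {ξ₀ : Heis n} (hξ : ξ₀ ∈ Ω) {u₀ : ℝ}
    {g g1 g2 : ℝ → ℝ} (hg : ∀ s, HasDerivAt g (g1 s) s)
    (hg1 : ∀ s, HasDerivAt g1 (g2 s) s) (hgc : ContDiff ℝ 2 g)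
    (h0 : v ξ₀ = (g u₀ : EReal)) {q : HIdx n → ℝ} {A : HMat n} (hA : A.IsSymm) {τ M : ℝ}
    (h : ∀ᶠ ζ in 𝓝 (0 : Heis n), ξ₀ + linH ξ₀ ζ ∈ Ω →
      v (ξ₀ + linH ξ₀ ζ) ≤ ((g (u₀ + qpoly q τ A M ζ) : ℝ) : EReal)) :
    g1 u₀ • A + g2 u₀ • vecMulVec q q + Lq a b c (g1 u₀ • q) ∈ closure S := by
  have := hv ξ₀ hξ (fun η => g (tfun ξ₀ u₀ q τ A M η))
    (hgc.comp (contDiff_tfun ξ₀ u₀ q τ A M)).contDiffOn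
    (by simp only [tfun_self, h0]) (by
      filter_upwards [(tendsto_linH_neg ξ₀).eventually h] with η hη
      rw [linH_linH_neg, add_sub_cancel] at hη
      exact hη)
  rwa [comp_Fop a b c hg hg1 ξ₀ u₀ q τ hA M] at this

lemma qpoly_zero (q : HIdx n → ℝ) (τ : ℝ) (A : HMat n) (M : ℝ) : qpoly q τ A M 0 = 0 := by
  simp [qpoly]

lemma sq_translate (ξ₀ ζ : Heis n) : ZL n (ξ₀ + linH ξ₀ ζ) ⬝ᵥ ZL n (ξ₀ + linH ξ₀ ζ)
    = ZL n ξ₀ ⬝ᵥ ZL n ξ₀ + 2 * (ZL n ξ₀ ⬝ᵥ ZL n ζ) + ZL n ζ ⬝ᵥ ZL n ζ := by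
  rw [map_add, ZL_linH, add_dotProduct, dotProduct_add, dotProduct_add,
    dotProduct_comm (ZL n ζ) (ZL n ξ₀)]
  ring

lemma qpoly_shift (q z0 : HIdx n → ℝ) (τ : ℝ) (A : HMat n) (M μ : ℝ) (ζ : Heis n) :
    qpoly (q - (2 * μ) • z0) τ (A - (2 * μ) • (1 : HMat n)) M ζ
      = qpoly q τ A M ζ - μ * (2 * (z0 ⬝ᵥ ZL n ζ) + ZL n ζ ⬝ᵥ ZL n ζ) := by
  unfold qpoly
  rw [sub_dotProduct, smul_dotProduct, Matrix.sub_mulVec, Matrix.smul_mulVec, Matrix.one_mulVec,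
    dotProduct_sub, dotProduct_smul]
  simp only [smul_eq_mul]
  ring

lemma continuous_zsq : Continuous (fun ξ : Heis n => ZL n ξ ⬝ᵥ ZL n ξ) :=
  (contDiff_dot (ZL n).contDiff (ZL n).contDiff).continuous

theorem strict_transform {Ω : Set (Heis n)} (hΩbdd : Bornology.IsBounded Ω)
    {S : Set (HMat n)} (hSsymm : ∀ A ∈ S, A.IsSymm)
    (hSpos : ∀ A ∈ S, ∀ B : HMat n, B.PosDef → A + B ∈ S)
    (hScone : ∀ A ∈ S, ∀ c : ℝ, 0 < c → c • A ∈ S)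
    {a b c : ℝ}
    (hstruct : (0 < b ∧ 0 ≤ c) ∨ (b < 0 ∧ c ≤ 0) ∨ (b = 0 ∧ c = 0))
    {v : Heis n → EReal} (hvsub : IsSubsolution Ω (LquadC a b c) S v)
    {v1 : Heis n → ℝ} (husc : UpperSemicontinuousOn v1 (closure Ω)) {R : ℝ}
    (hR : ∀ ξ ∈ closure Ω, |v1 ξ| ≤ R) (hR0 : 0 ≤ R)
    (hvv1 : ∀ ξ ∈ Ω, v ξ ≤ (v1 ξ : EReal)) {θ : ℝ} (hθ : 0 < θ) :
    ∃ κ : ℝ, 0 < κ ∧ ∃ V : Heis n → ℝ, UpperSemicontinuousOn V (closure Ω) ∧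
      (∀ ξ ∈ closure Ω, |V ξ - v1 ξ| ≤ θ) ∧
      ∀ ξ₀ ∈ Ω, v ξ₀ = (v1 ξ₀ : EReal) → ∀ (q : HIdx n → ℝ) (τ : ℝ) (A : HMat n) (M : ℝ),
        A.IsSymm → (∀ᶠ ζ in 𝓝 (0 : Heis n), ξ₀ + linH ξ₀ ζ ∈ Ω →
          V (ξ₀ + linH ξ₀ ζ) ≤ V ξ₀ + qpoly q τ A M ζ) →
        A + Lq a b c q - κ • (1 : HMat n) ∈ closure S := by
  obtain ⟨σ, hσ, hσb, hσc⟩ : ∃ σ : ℝ, |σ| = 1 ∧ σ * b = |b| ∧ σ * c = |c| := by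
    rcases hstruct with ⟨h1, h2⟩ | ⟨h1, h2⟩ | ⟨h1, h2⟩
    · exact ⟨1, by simp, by rw [abs_of_pos h1]; simp, by rw [abs_of_nonneg h2]; simp⟩
    · exact ⟨-1, by simp, by rw [abs_of_neg h1]; simp, by rw [abs_of_nonpos h2]; simp⟩
    · exact ⟨1, by simp, by rw [h1]; simp, by rw [h2]; simp⟩
  obtain ⟨Zb, hZb⟩ := (hΩbdd.isCompact_closure).exists_bound_of_continuousOn
    (continuous_zsq (n := n)).continuousOn
  set Zc := max Zb 0 with hZc
  have hZc0 : 0 ≤ Zc := le_max_right _ _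
  have hZ : ∀ ξ ∈ closure Ω, ZL n ξ ⬝ᵥ ZL n ξ ≤ Zc := fun ξ hξ =>
    (le_abs_self _).trans ((hZb ξ hξ).trans (le_max_left _ _))
  set Λ := 3 * |a| + 3 with hΛ
  have hΛ3 : 3 ≤ Λ := by have := abs_nonneg a; linarith
  have hΛ0 : 0 < Λ := by linarith
  set θ' := min θ 1 with hθ'
  have hθ'0 : 0 < θ' := lt_min hθ one_pos
  have hθ'1 : θ' ≤ 1 := min_le_right _ _
  set R' := R + 2 with hR'
  set δ := θ' / 2 * Real.exp (-(Λ * R')) with hδ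
  have hδ0 : 0 < δ := by positivity
  -- the elementary bounds
  set d : ℝ → ℝ := fun s => δ * Real.exp (-(σ * Λ * s)) with hdd
  have hd0 : ∀ s, 0 < d s := fun s => by positivity
  have hσs : ∀ s, |s| ≤ R' → |σ * Λ * s| ≤ Λ * R' := by
    intro s hs
    rw [abs_mul, abs_mul, hσ, one_mul, abs_of_pos hΛ0]
    gcongr
  have hdu : ∀ s, |s| ≤ R' → d s ≤ θ' / 2 := by
    intro s hs
    have h1 := (abs_le.1 (hσs s hs)).1
    have h2 : Real.exp (-(σ * Λ * s)) ≤ Real.exp (Λ * R') := Real.exp_le_exp.2 (by linarith)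
    calc d s ≤ δ * Real.exp (Λ * R') := by simp only [hdd]; gcongr
      _ = θ' / 2 := by rw [hδ, mul_assoc, ← Real.exp_add]; simp
  set d0 := δ * Real.exp (-(Λ * R')) with hd0'
  have hd00 : 0 < d0 := by positivity
  have hdl : ∀ s, |s| ≤ R' → d0 ≤ d s := by
    intro s hs
    have h1 := (abs_le.1 (hσs s hs)).2
    have h2 : Real.exp (-(Λ * R')) ≤ Real.exp (-(σ * Λ * s)) := Real.exp_le_exp.2 (by linarith)
    simp only [hdd, hd0']; gcongr
  set C := |a| + |b| + |c| with hC
  have hC0 : 0 ≤ C := by positivity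
  set μ := (θ' / 2) / ((1 / d0 + 1) * (C + 1) * (Zc + 1) * 4) with hμ
  have hμ0 : 0 < μ := by positivity
  have hμe : μ * ((1 / d0 + 1) * (C + 1) * (Zc + 1) * 4) = θ' / 2 := by
    rw [hμ, div_mul_cancel₀]; positivity
  have hd1 : 0 < 1 / d0 := by positivity
  have hμZ : μ * Zc ≤ θ' / 2 := by
    rw [← hμe]
    apply mul_le_mul_of_nonneg_left _ hμ0.le
    have h1 : 1 ≤ (1 / d0 + 1) * (C + 1) := by nlinarith
    nlinarith
  have hμC : ∀ d, d0 ≤ d → ∀ z, 0 ≤ z → z ≤ Zc → 4 * μ * (1 / d + 1) * C * z ≤ 1 := by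
    intro d hd z hz0 hz
    have hdp : 0 < d := hd00.trans_le hd
    have h1 : 1 / d ≤ 1 / d0 := one_div_le_one_div_of_le hd00 hd
    calc 4 * μ * (1 / d + 1) * C * z ≤ 4 * μ * (1 / d0 + 1) * (C + 1) * (Zc + 1) := by
          gcongr <;> linarith
      _ = μ * ((1 / d0 + 1) * (C + 1) * (Zc + 1) * 4) := by ring
      _ ≤ 1 := by rw [hμe]; linarith
  -- the change of variables
  set g : ℝ → ℝ := fun s => s - 1 / Λ * d s with hg
  have hσσ : σ * σ = 1 := by rw [← abs_mul_abs_self, hσ, one_mul]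
  have hdderiv : ∀ s, HasDerivAt d (-(σ * Λ) * d s) s := by
    intro s
    have h1 : HasDerivAt (fun s : ℝ => -(σ * Λ * s)) (-(σ * Λ * 1)) s :=
      ((hasDerivAt_id s).const_mul (σ * Λ)).neg
    have h2 := (h1.exp).const_mul δ
    exact h2.congr_deriv (by simp only [hdd]; ring)
  have hgd : ∀ s, HasDerivAt g (1 + σ * d s) s := by
    intro s
    have h1 : HasDerivAt g _ s := (hasDerivAt_id s).sub ((hdderiv s).const_mul (1 / Λ))
    refine h1.congr_deriv ?_
    rw [show 1 / Λ * (-(σ * Λ) * d s) = -(σ * d s * (Λ * (1 / Λ))) by ring,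
      mul_one_div_cancel hΛ0.ne']
    ring
  have hg1d : ∀ s, HasDerivAt (fun s => 1 + σ * d s) (-(Λ * d s)) s := by
    intro s
    have h1 := ((hdderiv s).const_mul σ).const_add 1
    refine h1.congr_deriv ?_
    rw [show σ * (-(σ * Λ) * d s) = -(σ * σ * Λ * d s) by ring, hσσ]
    ring
  have hgc : ContDiff ℝ 2 g := by
    simp only [hg, hdd]
    fun_prop
  have hgs : ∀ s, g s = s - 1 / Λ * d s := by
    intro s; rfl
  have hcor : ∀ s, |s| ≤ R' → 0 < 1 / Λ * d s ∧ 1 / Λ * d s ≤ θ' / 2 := by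
    intro s hs
    have h1 : 0 < 1 / Λ := by positivity
    have h2 : 1 / Λ ≤ 1 := by rw [div_le_one hΛ0]; linarith
    have := hd0 s
    exact ⟨by positivity, le_trans (by nlinarith) (hdu s hs)⟩
  have hg1b : ∀ s, |s| ≤ R' → 1 / 2 ≤ 1 + σ * d s ∧ 1 + σ * d s ≤ 3 / 2 := by
    intro s hs
    have h1 : |σ * d s| ≤ 1 / 2 := by
      rw [abs_mul, hσ, one_mul, abs_of_pos (hd0 s)]
      have := hdu s hs; linarith
    have := abs_le.1 h1
    constructor <;> linarith
  have hmono : StrictMonoOn g (Set.Icc (-R') R') := by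
    apply strictMonoOn_of_deriv_pos (convex_Icc _ _) hgc.continuous.continuousOn
    intro s hs
    rw [interior_Icc] at hs
    rw [(hgd s).deriv]
    have := (hg1b s (abs_le.2 ⟨hs.1.le, hs.2.le⟩)).1
    linarith
  have hex : ∀ ξ, ∃ s, ξ ∈ closure Ω → (|s| ≤ R + 1 ∧ g s = v1 ξ) := by
    intro ξ
    by_cases hξ : ξ ∈ closure Ω
    · have h1 := abs_le.1 (hR ξ hξ)
      have l1 := hcor (-(R + 1)) (by rw [abs_neg, abs_of_nonneg (by linarith)]; linarith)
      have l2 := hcor (R + 1) (by rw [abs_of_nonneg (by linarith)]; linarith)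
      have h2 : v1 ξ ∈ Set.Icc (g (-(R + 1))) (g (R + 1)) := by
        rw [hgs, hgs]
        constructor <;> linarith [l1.1, l2.2]
      obtain ⟨s, hs, hs'⟩ := intermediate_value_Icc (by linarith) hgc.continuous.continuousOn h2
      exact ⟨s, fun _ => ⟨abs_le.2 hs, hs'⟩⟩
    · exact ⟨0, fun h => absurd h hξ⟩
  choose s hs using hex
  have hsR : ∀ ξ ∈ closure Ω, |s ξ| ≤ R' := fun ξ hξ => (hs ξ hξ).1.trans (by linarith)
  have hsI : ∀ ξ ∈ closure Ω, s ξ ∈ Set.Icc (-R') R' := fun ξ hξ => abs_le.1 (hsR ξ hξ)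
  have hsusc : UpperSemicontinuousOn s (closure Ω) := by
    intro x hx y hy
    have hx1 := abs_le.1 (hs x hx).1
    set y' := min y R' with hy'
    have hy1 : s x < y' := lt_min hy (by linarith)
    have hy2 : y' ∈ Set.Icc (-R') R' := ⟨by linarith, min_le_right _ _⟩
    have h1 : v1 x < g y' := by
      rw [← (hs x hx).2]; exact hmono (hsI x hx) hy2 hy1
    have h2 := husc x hx (g y') h1
    filter_upwards [h2, self_mem_nhdsWithin] with η hη hηK
    rw [← (hs η hηK).2] at hη
    exact ((hmono.lt_iff_lt (hsI η hηK) hy2).1 hη).trans_le (min_le_left _ _)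
  refine ⟨μ / 2, half_pos hμ0, fun ξ => s ξ + μ * (ZL n ξ ⬝ᵥ ZL n ξ), ?_, ?_, ?_⟩
  · exact hsusc.add
      (continuous_const.mul continuous_zsq).continuousOn.upperSemicontinuousOn
  · intro ξ hξ
    have h1 := hcor _ (hsR ξ hξ)
    have h2 := (hs ξ hξ).2
    rw [hgs] at h2
    have h3 := mul_le_mul_of_nonneg_left (hZ ξ hξ) hμ0.le
    have h4 := mul_nonneg hμ0.le (dot_self_nonneg (ZL n ξ))
    have h5 : θ' ≤ θ := min_le_left _ _
    rw [abs_le]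
    constructor <;> linarith [h1.1, h1.2]
  · intro ξ₀ hξ₀ hveq q τ A M hA hjet
    have hξc := subset_closure hξ₀
    have hsR0 := hsR ξ₀ hξc
    have hA' : (A - (2 * μ) • (1 : HMat n)).IsSymm := hA.sub (Matrix.isSymm_one.smul _)
    have hmem := sub_jet_comp hvsub hξ₀ (u₀ := s ξ₀) hgd hg1d hgc
      (by rw [hveq, (hs ξ₀ hξc).2]) (q := q - (2 * μ) • ZL n ξ₀) hA' (τ := τ) (M := M) (by
        have hcont : Tendsto (fun ζ : Heis n => s ξ₀ + qpoly (q - (2 * μ) • ZL n ξ₀) τ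
            (A - (2 * μ) • (1 : HMat n)) M ζ) (𝓝 0) (𝓝 (s ξ₀)) := by
          have := (continuous_const.add (contDiff_qpoly (q - (2 * μ) • ZL n ξ₀) τ
            (A - (2 * μ) • (1 : HMat n)) M).continuous : Continuous fun ζ : Heis n =>
              s ξ₀ + qpoly (q - (2 * μ) • ZL n ξ₀) τ
            (A - (2 * μ) • (1 : HMat n)) M ζ).tendsto 0
          have e0 : s ξ₀ + qpoly (q - (2 * μ) • ZL n ξ₀) τ
            (A - (2 * μ) • (1 : HMat n)) M 0 = s ξ₀ := by rw [qpoly_zero, add_zero]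
          have h2 : Tendsto _ _ (𝓝 (s ξ₀ + qpoly (q - (2 * μ) • ZL n ξ₀) τ
            (A - (2 * μ) • (1 : HMat n)) M 0)) := this
          rw [e0] at h2
          exact h2
        have hb := abs_le.1 (hs ξ₀ hξc).1
        have hn := hcont.eventually (Icc_mem_nhds (show -R' < s ξ₀ by linarith)
          (show s ξ₀ < R' by linarith))
        filter_upwards [hn, hjet] with ζ hζ hζ2 hζΩ
        have h1 := hζ2 hζΩ
        have hηc := subset_closure hζΩ
        refine (hvv1 _ hζΩ).trans ?_
        rw [EReal.coe_le_coe_iff, ← (hs _ hηc).2]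
        refine (hmono.le_iff_le (hsI _ hηc) hζ).2 ?_
        rw [qpoly_shift]
        rw [sq_translate] at h1
        linarith)
    refine strict_mem hSsymm hSpos hScone hσb hσc hσ (hd0 (s ξ₀)) hμ0
      (by linarith [(hg1b _ hsR0).1]) (hg1b _ hsR0).2 rfl le_rfl
      (hμC _ (hdl _ hsR0) _ (dot_self_nonneg _) (hZ ξ₀ hξc)) hA hmem

end Transform

section SupConvolution

variable {n : ℕ}

/-- The squared Euclidean norm on `ℍⁿ`. -/
def Nq (ζ : Heis n) : ℝ := ZL n ζ ⬝ᵥ ZL n ζ + TL n ζ ^ 2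

/-- The Euclidean scalar product. -/
def ipL (A : Heis n) : Heis n →L[ℝ] ℝ := (dotL (ZL n A)).comp (ZL n) + (TL n A) • TL n

lemma ipL_apply (A B : Heis n) : ipL A B = ZL n A ⬝ᵥ ZL n B + TL n A * TL n B := rfl

lemma Nq_nonneg (ζ : Heis n) : 0 ≤ Nq ζ := add_nonneg (dot_self_nonneg _) (sq_nonneg _)

lemma Nq_zero : Nq (0 : Heis n) = 0 := by simp [Nq]

lemma Nq_add (A B : Heis n) : Nq (A + B) = Nq A + 2 * ipL A B + Nq B := by
  simp only [Nq, ipL_apply, map_add, add_dotProduct, dotProduct_add]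
  rw [dotProduct_comm (ZL n B) (ZL n A)]
  ring

lemma Nq_smul (t : ℝ) (A : Heis n) : Nq (t • A) = t ^ 2 * Nq A := by
  simp only [Nq, map_smul, smul_dotProduct, dotProduct_smul, smul_eq_mul]
  ring

lemma Nq_eq_zero {ζ : Heis n} (h : Nq ζ = 0) : ζ = 0 := by
  have h1 := dot_self_nonneg (ZL n ζ)
  have h2 := sq_nonneg (TL n ζ)
  have h3 : ZL n ζ ⬝ᵥ ZL n ζ = 0 := by unfold Nq at h; linarith
  have h4 : TL n ζ ^ 2 = 0 := by unfold Nq at h; linarith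
  apply heis_ext
  · rw [map_zero]; exact dotProduct_self_eq_zero.1 h3
  · rw [map_zero]; exact pow_eq_zero_iff (two_ne_zero) |>.1 h4

lemma ipL_sq_le (A B : Heis n) : (ipL A B) ^ 2 ≤ Nq A * Nq B := by
  rw [ipL_apply, Nq, Nq]
  have h := dot_sq_le (ZL n A) (ZL n B)
  have ha := dot_self_nonneg (ZL n A)
  have hb := dot_self_nonneg (ZL n B)
  generalize ZL n A ⬝ᵥ ZL n B = x at *
  generalize ZL n A ⬝ᵥ ZL n A = p at *
  generalize ZL n B ⬝ᵥ ZL n B = q at *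
  generalize TL n A = s at *
  generalize TL n B = t at *
  have h1 : 2 * x * (s * t) ≤ p * t ^ 2 + q * s ^ 2 := by
    have h2 : |x * (s * t)| ≤ (p * t ^ 2 + q * s ^ 2) / 2 := by
      apply abs_le_of_sq_le_sq _ (by positivity)
      have h3 := mul_le_mul_of_nonneg_right h (sq_nonneg (s * t))
      nlinarith [sq_nonneg (p * t ^ 2 - q * s ^ 2)]
    linarith [(abs_le.1 h2).2]
  nlinarith

lemma norm_sq_le_Nq (ζ : Heis n) : ‖ζ‖ ^ 2 ≤ Nq ζ := by
  have key : ∀ i, (ZL n ζ i) ^ 2 ≤ Nq ζ := by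
    intro i
    have h1 : (ZL n ζ i) ^ 2 ≤ ZL n ζ ⬝ᵥ ZL n ζ := by
      rw [pow_two]
      exact Finset.single_le_sum (f := fun i => ZL n ζ i * ZL n ζ i)
        (fun i _ => mul_self_nonneg _) (Finset.mem_univ i)
    have h2 := sq_nonneg (TL n ζ)
    unfold Nq; linarith
  have key2 : (TL n ζ) ^ 2 ≤ Nq ζ := by
    have h1 := dot_self_nonneg (ZL n ζ)
    unfold Nq; linarith
  have h : ‖ζ‖ ≤ Real.sqrt (Nq ζ) := by
    rw [Prod.norm_def, Prod.norm_def]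
    refine max_le ?_ (max_le ?_ ?_)
    · rw [pi_norm_le_iff_of_nonneg (Real.sqrt_nonneg _)]
      intro i
      exact Real.abs_le_sqrt (key (Sum.inl i))
    · rw [pi_norm_le_iff_of_nonneg (Real.sqrt_nonneg _)]
      intro i
      exact Real.abs_le_sqrt (key (Sum.inr i))
    · exact Real.abs_le_sqrt key2
  calc ‖ζ‖ ^ 2 ≤ Real.sqrt (Nq ζ) ^ 2 := by gcongr
    _ = Nq ζ := Real.sq_sqrt (Nq_nonneg ζ)

lemma continuous_Nq_linH : Continuous (fun p : Heis n × Heis n => Nq (linH p.1 p.2)) := by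
  simp only [Nq, ZL_linH, TL_linH]
  have h1 : ContDiff ℝ 2 (fun p : Heis n × Heis n => ZL n p.1) :=
    (ZL n).contDiff.comp contDiff_fst
  have h2 : ContDiff ℝ 2 (fun p : Heis n × Heis n => ZL n p.2) :=
    (ZL n).contDiff.comp contDiff_snd
  have h3 : ContDiff ℝ 2 (fun p : Heis n × Heis n => TL n p.2) :=
    (TL n).contDiff.comp contDiff_snd
  exact ((contDiff_dot h2 h2).add ((h3.add (contDiff_const.mul
    (contDiff_dot h2 (contDiff_mulVec _ h1)))).pow 2)).continuous

lemma Nq_linH_bound {K : Set (Heis n)} (hK : IsCompact K) :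
    ∃ C, 0 ≤ C ∧ ∀ η ∈ K, ∀ k, Nq (linH η k) ≤ C * ‖k‖ ^ 2 := by
  obtain ⟨C, hC⟩ := (hK.prod (isCompact_closedBall (0 : Heis n) 1)).exists_bound_of_continuousOn
    (continuous_Nq_linH (n := n)).continuousOn
  refine ⟨max C 0, le_max_right _ _, fun η hη k => ?_⟩
  by_cases hk : k = 0
  · simp [hk, Nq_zero]
  have hk' : 0 < ‖k‖ := norm_pos_iff.2 hk
  have h1 := hC (η, ‖k‖⁻¹ • k) ⟨hη, by
    rw [mem_closedBall_zero_iff, norm_smul, norm_inv, norm_norm, inv_mul_cancel₀ hk'.ne']⟩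
  have h2 : Nq (linH η k) = ‖k‖ ^ 2 * Nq (linH η (‖k‖⁻¹ • k)) := by
    rw [← Nq_smul, ← map_smul, smul_smul, mul_inv_cancel₀ hk'.ne', one_smul]
  rw [h2, mul_comm]
  gcongr
  exact (le_abs_self _).trans (h1.trans (le_max_left _ _))

/-- Sup-convolution. -/
theorem sup_convolution {K : Set (Heis n)} (hK : IsCompact K) (hne : K.Nonempty)
    {U : Heis n → ℝ} (hU : UpperSemicontinuousOn U K) {l : ℝ} (hl : 0 < l) :
    ∃ (F : Heis n → ℝ) (e : Heis n → Heis n) (q : Heis n → (Heis n →L[ℝ] ℝ)) (C Q : ℝ),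
      0 ≤ C ∧ (∀ ξ, e ξ ∈ K) ∧ (∀ ξ, F ξ = U (e ξ) - l * Nq (linH (e ξ) (ξ - e ξ))) ∧
      (∀ ξ, ∀ η ∈ K, U η - l * Nq (linH η (ξ - η)) ≤ F ξ) ∧
      (∀ z y, F z + q z (y - z) - C * ‖y - z‖ ^ 2 ≤ F y) ∧ (∀ z ∈ K, ‖q z‖ ≤ Q) := by
  have hmax : ∀ ξ, ∃ η ∈ K, ∀ η' ∈ K,
      U η' - l * Nq (linH η' (ξ - η')) ≤ U η - l * Nq (linH η (ξ - η)) := by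
    intro ξ
    have hc : Continuous (fun η : Heis n => -(l * Nq (linH η (ξ - η)))) :=
      (continuous_const.mul (continuous_Nq_linH.comp
        (continuous_id.prodMk (continuous_const.sub continuous_id)))).neg
    obtain ⟨η, hη, h⟩ := UpperSemicontinuousOn.exists_isMaxOn hne hK
      (hU.add hc.continuousOn.upperSemicontinuousOn)
    refine ⟨η, hη, fun η' hη' => ?_⟩
    have := h hη'
    simp only [Set.mem_setOf_eq] at this
    linarith
  choose e he hmax using hmax
  obtain ⟨C1, hC1, hN⟩ := Nq_linH_bound hK
  obtain ⟨D, hD⟩ := hK.isBounded.exists_norm_le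
  refine ⟨fun ξ => U (e ξ) - l * Nq (linH (e ξ) (ξ - e ξ)), e,
    fun z => (-(2 * l)) • (ipL (linH (e z) (z - e z))).comp (linH (e z)), l * C1,
    2 * l * (C1 * (2 * D)), by positivity, he, fun ξ => rfl, hmax, ?_, ?_⟩
  · intro z y
    have h1 := hmax y (e z) (he z)
    have h2 : linH (e z) (y - e z) = linH (e z) (z - e z) + linH (e z) (y - z) := by
      rw [← map_add]; congr 1; abel
    rw [h2, Nq_add] at h1
    have h3 := hN (e z) (he z) (y - z)
    have h4 := mul_le_mul_of_nonneg_left h3 hl.le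
    simp only [_root_.smul_apply, ContinuousLinearMap.comp_apply, smul_eq_mul]
    linarith
  · intro z hz
    have hD0 : 0 ≤ D := (norm_nonneg _).trans (hD z hz)
    refine ContinuousLinearMap.opNorm_le_bound _ (by positivity) fun k => ?_
    simp only [_root_.smul_apply, ContinuousLinearMap.comp_apply, smul_eq_mul]
    rw [norm_mul, norm_neg, Real.norm_of_nonneg (by positivity : 0 ≤ 2 * l), mul_assoc (2 * l)]
    gcongr
    rw [Real.norm_eq_abs]
    apply abs_le_of_sq_le_sq _ (by positivity)
    refine (ipL_sq_le _ _).trans ?_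
    have h1 := hN (e z) (he z) k
    have h2 := hN (e z) (he z) (z - e z)
    have h3 : ‖z - e z‖ ≤ 2 * D := (norm_sub_le _ _).trans (by linarith [hD z hz, hD _ (he z)])
    calc _ ≤ (C1 * (2 * D) ^ 2) * (C1 * ‖k‖ ^ 2) := by
          apply mul_le_mul _ h1 (Nq_nonneg _) (by positivity)
          refine h2.trans ?_
          gcongr
      _ = _ := by ring

/-- Transfer of jets through sup-convolution. -/
lemma sup_conv_jet {K : Set (Heis n)} {U F : Heis n → ℝ} {l : ℝ} {ξ η : Heis n}
    (h1 : F ξ = U η - l * Nq (linH η (ξ - η)))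
    (h2 : ∀ ξ, ∀ η ∈ K, U η - l * Nq (linH η (ξ - η)) ≤ F ξ) {P : Heis n → ℝ}
    (hP : ∀ᶠ ζ in 𝓝 (0 : Heis n), F (ξ + linH ξ ζ) ≤ F ξ + P ζ) :
    ∀ᶠ ζ in 𝓝 (0 : Heis n), η + linH η ζ ∈ K → U (η + linH η ζ) ≤ U η + P ζ := by
  filter_upwards [hP] with ζ hζ hK
  have h3 := h2 (ξ + linH ξ ζ) _ hK
  rw [linH_translate] at h3
  linarith

/-- Horizontal embedding. -/
def embH (n : ℕ) : (HIdx n → ℝ) →L[ℝ] Heis n :=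
  LinearMap.toContinuousLinearMap
    { toFun := fun z => (fun i => z (Sum.inl i), fun i => z (Sum.inr i), 0)
      map_add' := by intro x y; ext <;> simp
      map_smul' := by intro x y; ext <;> simp }

/-- Vertical unit vector. -/
def vertH (n : ℕ) : Heis n := (0, 0, 1)

lemma ZL_embH (z : HIdx n → ℝ) : ZL n (embH n z) = z := by
  ext i; rcases i with i | i <;> rfl

lemma TL_embH (z : HIdx n → ℝ) : TL n (embH n z) = 0 := rfl

lemma embH_decomp (ζ : Heis n) : ζ = embH n (ZL n ζ) + TL n ζ • vertH n := by
  apply heis_ext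
  · rw [map_add, ZL_embH, map_smul]
    have : ZL n (vertH n) = 0 := by
      ext i; rcases i with i | i <;> rfl
    rw [this]; simp
  · rw [map_add, TL_embH, map_smul]
    have : TL n (vertH n) = 1 := rfl
    rw [this]; simp

/-- Horizontal gradient from the Euclidean one. -/
def gradH (x : Heis n) (p : Heis n →L[ℝ] ℝ) : HIdx n → ℝ :=
  fun i => p (linH x (embH n (Pi.single i 1)))

/-- Horizontal Hessian from the Euclidean one. -/
def hessH (x : Heis n) (A : Heis n →L[ℝ] (Heis n →L[ℝ] ℝ)) : HMat n :=
  Matrix.of fun i j => 1 / 2 * (A (linH x (embH n (Pi.single i 1))) (linH x (embH n (Pi.single j 1)))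
    + A (linH x (embH n (Pi.single j 1))) (linH x (embH n (Pi.single i 1))))

lemma hessH_isSymm (x : Heis n) (A : Heis n →L[ℝ] (Heis n →L[ℝ] ℝ)) : (hessH x A).IsSymm := by
  ext i j
  simp [hessH, add_comm]

lemma vec_sum (z : HIdx n → ℝ) : z = ∑ i, z i • (Pi.single i (1 : ℝ) : HIdx n → ℝ) := by
  ext j
  simp [Finset.sum_apply, Pi.single_apply]

lemma gradH_dot (x : Heis n) (p : Heis n →L[ℝ] ℝ) (z : HIdx n → ℝ) :
    gradH x p ⬝ᵥ z = p (linH x (embH n z)) := by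
  conv_rhs => rw [vec_sum z]
  simp only [map_sum, map_smul, smul_eq_mul, dotProduct, gradH]
  exact Finset.sum_congr rfl fun i _ => mul_comm _ _

lemma hessH_quad (x : Heis n) (A : Heis n →L[ℝ] (Heis n →L[ℝ] ℝ)) (z : HIdx n → ℝ) :
    z ⬝ᵥ (hessH x A *ᵥ z) = A (linH x (embH n z)) (linH x (embH n z)) := by
  have h : A (linH x (embH n z)) (linH x (embH n z))
      = ∑ i, ∑ j, z i * z j * A (linH x (embH n (Pi.single i 1)))
          (linH x (embH n (Pi.single j 1))) := by
    conv_lhs => rw [vec_sum z]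
    simp only [map_sum, map_smul, _root_.sum_apply, _root_.smul_apply, smul_eq_mul,
      Finset.mul_sum]
    rw [Finset.sum_comm]
    exact Finset.sum_congr rfl fun i _ => Finset.sum_congr rfl fun j _ => by ring
  have h' : A (linH x (embH n z)) (linH x (embH n z))
      = ∑ i, ∑ j, z i * z j * A (linH x (embH n (Pi.single j 1)))
          (linH x (embH n (Pi.single i 1))) := by
    rw [h, Finset.sum_comm]
    exact Finset.sum_congr rfl fun i _ => Finset.sum_congr rfl fun j _ => by ring
  have h2 : A (linH x (embH n z)) (linH x (embH n z)) = 1 / 2 *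
      (A (linH x (embH n z)) (linH x (embH n z)) + A (linH x (embH n z)) (linH x (embH n z))) := by
    ring
  rw [h2]
  nth_rewrite 1 [h]
  rw [h', ← Finset.sum_add_distrib, Finset.mul_sum]
  simp only [dotProduct, Matrix.mulVec, hessH, Matrix.of_apply, Finset.mul_sum]
  refine Finset.sum_congr rfl fun i _ => ?_
  rw [← Finset.sum_add_distrib, Finset.mul_sum]
  exact Finset.sum_congr rfl fun j _ => by ring

/-- From a Euclidean second order upper expansion to a Heisenberg jet. -/
lemma euclid_to_jet {f : Heis n → ℝ} {x : Heis n} {p : Heis n →L[ℝ] ℝ}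
    {A : Heis n →L[ℝ] (Heis n →L[ℝ] ℝ)}
    (h : ∀ ε > 0, ∃ δ > 0, ∀ h, ‖h‖ ≤ δ →
      f (x + h) ≤ f x + p h + 1 / 2 * A h h + ε * ‖h‖ ^ 2) {ε : ℝ} (hε : 0 < ε) :
    ∃ τ M, ∀ᶠ ζ in 𝓝 (0 : Heis n), f (x + linH x ζ) ≤ f x
      + qpoly (gradH x p) τ (hessH x A + ε • (1 : HMat n)) M ζ := by
  set L := ‖linH x‖ with hL
  have hL0 : 0 ≤ L := norm_nonneg _
  set ε1 := ε / (4 * (L ^ 2 + 1)) with hε1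
  have hε10 : 0 < ε1 := by positivity
  have hε1L : ε1 * L ^ 2 ≤ ε / 4 := by
    have : ε1 * (4 * (L ^ 2 + 1)) = ε := by rw [hε1, div_mul_cancel₀]; positivity
    nlinarith
  obtain ⟨δ, hδ, hh⟩ := h ε1 hε10
  set e := linH x (vertH n) with he
  set k := ‖A‖ * ‖e‖ with hk
  set M := 1 / 2 * |A e e| + k ^ 2 * L ^ 2 / ε + ε / 4 with hM
  refine ⟨p e, M, ?_⟩
  have hev : ∀ᶠ ζ in 𝓝 (0 : Heis n), ‖linH x ζ‖ ≤ δ := by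
    have : Tendsto (fun ζ => ‖linH x ζ‖) (𝓝 0) (𝓝 0) := by
      have := (linH x).continuous.norm.tendsto 0
      simpa using this
    exact (this.eventually (gt_mem_nhds hδ)).mono fun _ h => le_of_lt h
  filter_upwards [hev] with ζ hζ
  refine (hh _ hζ).trans ?_
  set z := ZL n ζ with hz
  set t := TL n ζ with ht
  set h1 := linH x (embH n z) with hh1
  have hdec : linH x ζ = h1 + t • e := by
    conv_lhs => rw [embH_decomp ζ]
    rw [map_add, map_smul]
  have hn : ‖linH x ζ‖ ^ 2 ≤ L ^ 2 * (z ⬝ᵥ z + t ^ 2) := by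
    have a1 : ‖linH x ζ‖ ≤ L * ‖ζ‖ := (linH x).le_opNorm ζ
    have a2 := norm_sq_le_Nq ζ
    calc ‖linH x ζ‖ ^ 2 ≤ (L * ‖ζ‖) ^ 2 := by gcongr
      _ = L ^ 2 * ‖ζ‖ ^ 2 := by ring
      _ ≤ _ := by gcongr; exact a2
  have hn1 : ‖h1‖ ^ 2 ≤ L ^ 2 * (z ⬝ᵥ z) := by
    have a1 : ‖h1‖ ≤ L * ‖embH n z‖ := (linH x).le_opNorm _
    have a2 := norm_sq_le_Nq (embH n z)
    rw [Nq, ZL_embH, TL_embH] at a2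
    calc ‖h1‖ ^ 2 ≤ (L * ‖embH n z‖) ^ 2 := by gcongr
      _ = L ^ 2 * ‖embH n z‖ ^ 2 := by ring
      _ ≤ _ := by gcongr; simpa using a2
  have hzz := dot_self_nonneg z
  have hn' : ε1 * ‖linH x ζ‖ ^ 2 ≤ ε / 4 * (z ⬝ᵥ z + t ^ 2) := by
    calc _ ≤ ε1 * (L ^ 2 * (z ⬝ᵥ z + t ^ 2)) := by gcongr
      _ = (ε1 * L ^ 2) * (z ⬝ᵥ z + t ^ 2) := by ring
      _ ≤ _ := by gcongr
  have hA : A (linH x ζ) (linH x ζ) = z ⬝ᵥ (hessH x A *ᵥ z)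
      + t * (A h1 e + A e h1) + t ^ 2 * A e e := by
    rw [hessH_quad, hdec]
    simp only [map_add, map_smul, _root_.add_apply, _root_.smul_apply, smul_eq_mul]
    ring
  have hp : p (linH x ζ) = gradH x p ⬝ᵥ z + p e * t := by
    rw [gradH_dot, hdec, map_add, map_smul, smul_eq_mul, mul_comm t]
  have hcross : |A h1 e + A e h1| ≤ 2 * k * ‖h1‖ := by
    have a1 : |A h1 e| ≤ ‖A‖ * ‖h1‖ * ‖e‖ := A.le_opNorm₂ h1 e
    have a2 : |A e h1| ≤ ‖A‖ * ‖e‖ * ‖h1‖ := A.le_opNorm₂ e h1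
    refine (abs_add_le _ _).trans ?_
    rw [hk]; linarith
  have hcross2 : 1 / 2 * (t * (A h1 e + A e h1)) ≤ ε / 4 * (z ⬝ᵥ z) + k ^ 2 * L ^ 2 / ε * t ^ 2 := by
    have a1 : t * (A h1 e + A e h1) ≤ |t| * (2 * k * ‖h1‖) := by
      refine (le_abs_self _).trans ?_
      rw [abs_mul]; gcongr
    have a2 : k * |t| * ‖h1‖ ≤ ε / 4 * (z ⬝ᵥ z) + k ^ 2 * L ^ 2 / ε * t ^ 2 := by
      by_cases hL00 : L = 0
      · have : ‖h1‖ ^ 2 ≤ 0 := by rw [hL00] at hn1; simpa using hn1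
        have : ‖h1‖ = 0 := by
          have := sq_nonneg ‖h1‖
          exact pow_eq_zero_iff two_ne_zero |>.1 (by linarith)
        rw [this, mul_zero]; positivity
      · have hLp : 0 < L := lt_of_le_of_ne hL0 (Ne.symm hL00)
        have b1 : ‖h1‖ ^ 2 / L ^ 2 ≤ z ⬝ᵥ z := by rw [div_le_iff₀ (by positivity)]; linarith
        have b2 : k * |t| * ‖h1‖ ≤ ε / 4 * (‖h1‖ ^ 2 / L ^ 2) + k ^ 2 * L ^ 2 / ε * t ^ 2 := by
          have b3 := sq_nonneg (ε * ‖h1‖ - 2 * k * L ^ 2 * |t|)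
          rw [← sq_abs t]
          have : 0 ≤ ε / 4 * (‖h1‖ ^ 2 / L ^ 2) + k ^ 2 * L ^ 2 / ε * |t| ^ 2 - k * |t| * ‖h1‖ := by
            have e1 : ε / 4 * (‖h1‖ ^ 2 / L ^ 2) + k ^ 2 * L ^ 2 / ε * |t| ^ 2 - k * |t| * ‖h1‖
              = (ε * ‖h1‖ - 2 * k * L ^ 2 * |t|) ^ 2 / (4 * ε * L ^ 2) := by
              field_simp
              ring
            rw [e1]; positivity
          linarith
        have b4 : ε / 4 * (‖h1‖ ^ 2 / L ^ 2) ≤ ε / 4 * (z ⬝ᵥ z) := by gcongr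
        linarith
    linarith
  have hee : 1 / 2 * (t ^ 2 * A e e) ≤ 1 / 2 * |A e e| * t ^ 2 := by
    have := mul_le_mul_of_nonneg_left (le_abs_self (A e e)) (sq_nonneg t)
    linarith
  rw [hA, hp]
  unfold qpoly
  rw [← hz, ← ht, Matrix.add_mulVec, Matrix.smul_mulVec, Matrix.one_mulVec, dotProduct_add,
    dotProduct_smul, smul_eq_mul, hM]
  linarith

lemma gradH_add (x : Heis n) (p p' : Heis n →L[ℝ] ℝ) :
    gradH x (p + p') = gradH x p + gradH x p' := by
  ext i; simp [gradH]

/-- Uniform bound for the horizontal gradient. -/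
lemma gradH_bound {K : Set (Heis n)} (hK : IsCompact K) :
    ∃ G : ℝ, 0 ≤ G ∧ ∀ x ∈ K, ∀ p : Heis n →L[ℝ] ℝ, gradH x p ⬝ᵥ gradH x p ≤ G * ‖p‖ ^ 2 := by
  obtain ⟨C, hC, hN⟩ := Nq_linH_bound hK
  refine ⟨((Fintype.card (HIdx n) : ℕ) : ℝ) * C, by positivity, fun x hx p => ?_⟩
  have hi : ∀ i, gradH x p i * gradH x p i ≤ C * ‖p‖ ^ 2 := by
    intro i
    set k := embH n (Pi.single i (1 : ℝ)) with hk
    have h1 : ‖k‖ ^ 2 ≤ 1 := by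
      have := norm_sq_le_Nq k
      rw [Nq, hk, ZL_embH, TL_embH] at this
      simpa using this
    have h2 : ‖linH x k‖ ^ 2 ≤ C := by
      refine (norm_sq_le_Nq _).trans ((hN x hx k).trans ?_)
      nlinarith
    have h3 : |p (linH x k)| ≤ ‖p‖ * ‖linH x k‖ := p.le_opNorm _
    have h4 : gradH x p i * gradH x p i = |p (linH x k)| ^ 2 := by
      rw [sq_abs, pow_two]; rfl
    rw [h4]
    calc |p (linH x k)| ^ 2 ≤ (‖p‖ * ‖linH x k‖) ^ 2 := by gcongr
      _ = ‖linH x k‖ ^ 2 * ‖p‖ ^ 2 := by ring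
      _ ≤ _ := by gcongr
  calc gradH x p ⬝ᵥ gradH x p ≤ ∑ _i : HIdx n, C * ‖p‖ ^ 2 := Finset.sum_le_sum fun i _ => hi i
    _ = _ := by simp [mul_assoc]

end SupConvolution

section Assembly

variable {n : ℕ}

lemma usc_bound {K : Set (Heis n)} (hK : IsCompact K) {v : Heis n → EReal}
    (hv : UpperSemicontinuousOn v K) (htop : ∀ ξ ∈ K, v ξ ≠ ⊤) :
    ∃ M : ℝ, 0 ≤ M ∧ ∀ ξ ∈ K, v ξ ≤ (M : EReal) := by
  rcases K.eq_empty_or_nonempty with h | h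
  · exact ⟨0, le_rfl, by simp [h]⟩
  · obtain ⟨η, hη, hm⟩ := hv.exists_isMaxOn h hK
    refine ⟨max 0 (v η).toReal, le_max_left _ _, fun ξ hξ => ?_⟩
    have h1 : v ξ ≤ v η := hm hξ
    refine h1.trans ((EReal.le_coe_toReal (htop η hη)).trans ?_)
    exact_mod_cast le_max_right _ _

lemma usc_trunc {K : Set (Heis n)} {v : Heis n → EReal}
    (hv : UpperSemicontinuousOn v K) {M N : ℝ} (hM : ∀ ξ ∈ K, v ξ ≤ (M : EReal)) :
    ∃ v1 : Heis n → ℝ, UpperSemicontinuousOn v1 K ∧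
      ∀ ξ ∈ K, (v1 ξ : EReal) = max (v ξ) (N : EReal) := by
  have key : ∀ ξ ∈ K, ((max (v ξ) (N : EReal)).toReal : EReal) = max (v ξ) (N : EReal) := by
    intro ξ hξ
    apply EReal.coe_toReal
    · apply ne_of_lt
      exact max_lt ((hM ξ hξ).trans_lt (EReal.coe_lt_top _)) (EReal.coe_lt_top _)
    · apply ne_of_gt
      exact lt_max_of_lt_right (EReal.bot_lt_coe _)
  refine ⟨fun ξ => (max (v ξ) (N : EReal)).toReal, ?_, key⟩
  intro ξ hξ y hy
  have h1 : max (v ξ) (N : EReal) < (y : EReal) := by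
    rw [← key ξ hξ]; exact_mod_cast hy
  have h2 := hv ξ hξ y (lt_of_le_of_lt (le_max_left _ _) h1)
  filter_upwards [h2, self_mem_nhdsWithin] with η hη hηK
  have h3 : max (v η) (N : EReal) < (y : EReal) :=
    max_lt hη (lt_of_le_of_lt (le_max_right _ _) h1)
  rw [← key η hηK] at h3
  exact_mod_cast h3

lemma continuous_Nq_linH_comp {X : Type*} [TopologicalSpace X] {f g : X → Heis n}
    (hf : Continuous f) (hg : Continuous g) :
    Continuous (fun x => Nq (linH (f x) (g x))) := by
  have h1 : Continuous (fun x => (f x, g x)) := hf.prodMk hg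
  have h2 := continuous_Nq_linH.comp h1
  exact h2

lemma continuous_penalty : Continuous (fun p : Heis n × Heis n × Heis n =>
      Nq (linH p.2.1 (p.1 - p.2.1)) + Nq (linH p.2.2 (p.1 - p.2.2))) := by
  have c1 : Continuous (fun p : Heis n × Heis n × Heis n => p.1) := continuous_fst
  have c2 : Continuous (fun p : Heis n × Heis n × Heis n => p.2.1) :=
    continuous_fst.comp continuous_snd
  have c3 : Continuous (fun p : Heis n × Heis n × Heis n => p.2.2) :=
    continuous_snd.comp continuous_snd
  exact (continuous_Nq_linH_comp c2 (c1.sub c2)).add (continuous_Nq_linH_comp c3 (c1.sub c3))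

lemma penalty_gap {Ω K : Set (Heis n)} (hΩ : IsOpen Ω) (hK : IsCompact K)
    {V U : Heis n → ℝ} (hV : UpperSemicontinuousOn V K) (hU : UpperSemicontinuousOn U K)
    {s s' : ℝ} (hs : s < s') (hfr : ∀ ξ ∈ K, ξ ∉ Ω → V ξ + U ξ ≤ s) :
    ∃ ν : ℝ, 0 < ν ∧ ∀ ξ ∈ K, ∀ η ∈ K, ∀ ζ ∈ K, s' ≤ V η + U ζ →
      Nq (linH η (ξ - η)) + Nq (linH ζ (ξ - ζ)) < ν → ξ ∈ Ω ∧ η ∈ Ω ∧ ζ ∈ Ω := by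
  set K3 : Set (Heis n × Heis n × Heis n) := K ×ˢ K ×ˢ K with hK3
  have hK3c : IsCompact K3 := hK.prod (hK.prod hK)
  have husc : UpperSemicontinuousOn (fun p : Heis n × Heis n × Heis n => V p.2.1 + U p.2.2) K3 := by
    have c1 : ContinuousOn (fun p : Heis n × Heis n × Heis n => p.2.1) K3 := by fun_prop
    have c2 : ContinuousOn (fun p : Heis n × Heis n × Heis n => p.2.2) K3 := by fun_prop
    exact (hV.comp c1 (fun p hp => hp.2.1)).add (hU.comp c2 (fun p hp => hp.2.2))
  obtain ⟨u, hu, hKu⟩ := upperSemicontinuousOn_iff_preimage_Iio.1 husc s'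
  set O : Set (Heis n × Heis n × Heis n) := Ω ×ˢ Ω ×ˢ Ω with hO
  have hOo : IsOpen O := hΩ.prod (hΩ.prod hΩ)
  have hT : IsCompact (K3 ∩ (uᶜ ∩ Oᶜ)) :=
    hK3c.inter_right (hu.isClosed_compl.inter hOo.isClosed_compl)
  have hTmem : ∀ p ∈ K3, (p ∈ uᶜ ↔ s' ≤ V p.2.1 + U p.2.2) := by
    intro p hp
    have h1 : p ∈ K3 ∩ (fun p : Heis n × Heis n × Heis n => V p.2.1 + U p.2.2) ⁻¹' Set.Iio s'
      ↔ p ∈ K3 ∩ u := by rw [hKu]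
    simp only [Set.mem_inter_iff, hp, true_and, Set.mem_preimage, Set.mem_Iio] at h1
    rw [Set.mem_compl_iff, ← h1, not_lt]
  have hcont := continuous_penalty (n := n)
  have hz : ∀ ξ η : Heis n, Nq (linH η (ξ - η)) = 0 → ξ = η := by
    intro ξ η h
    have h1 := Nq_eq_zero h
    have h2 := linH_neg_linH η (ξ - η)
    rw [h1, map_zero] at h2
    exact sub_eq_zero.1 h2.symm
  obtain ⟨ν, hν, hmin⟩ := hT.exists_forall_le' hcont.continuousOn (a := 0) (by
    rintro ⟨ξ, η, ζ⟩ ⟨hpK, hpu, hpO⟩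
    rw [hTmem _ hpK] at hpu
    have n1 := Nq_nonneg (linH η (ξ - η))
    have n2 := Nq_nonneg (linH ζ (ξ - ζ))
    by_contra hc
    push Not at hc
    simp only at hc
    have e1 := hz ξ η (by linarith)
    have e2 := hz ξ ζ (by linarith)
    subst e1
    subst e2
    have h3 : ξ ∉ Ω := fun h => hpO ⟨h, h, h⟩
    have := hfr ξ hpK.1 h3
    simp only at hpu
    linarith)
  refine ⟨ν, hν, fun ξ hξ η hη ζ hζ h1 h2 => ?_⟩
  by_contra hc
  have hp : ((ξ, η, ζ) : Heis n × Heis n × Heis n) ∈ K3 := ⟨hξ, hη, hζ⟩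
  have := hmin (ξ, η, ζ) ⟨hp, (hTmem _ hp).2 h1, fun h => hc h⟩
  simp only at this
  linarith

lemma semiconvex_continuousOn {K : Set (Heis n)} {F : Heis n → ℝ}
    {q : Heis n → (Heis n →L[ℝ] ℝ)} {C Q : ℝ}
    (h : ∀ z y, F z + q z (y - z) - C * ‖y - z‖ ^ 2 ≤ F y) (hQ : ∀ z ∈ K, ‖q z‖ ≤ Q) :
    ContinuousOn F K := by
  intro z hz
  have hb : ∀ y ∈ K, dist (F y) (F z) ≤ Q * ‖y - z‖ + C * ‖y - z‖ ^ 2 := by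
    intro y hy
    have h1 := h z y
    have h2 := h y z
    have h3 := (abs_le.1 ((q z).le_opNorm (y - z))).1
    have h4 := (abs_le.1 ((q y).le_opNorm (z - y))).1
    rw [norm_sub_rev z y] at h2 h4
    have h5 := mul_le_mul_of_nonneg_right (hQ z hz) (norm_nonneg (y - z))
    have h6 := mul_le_mul_of_nonneg_right (hQ y hy) (norm_nonneg (y - z))
    rw [Real.dist_eq, abs_le]
    constructor <;> linarith
  refine tendsto_iff_dist_tendsto_zero.2 ?_
  have ht : Tendsto (fun y => Q * ‖y - z‖ + C * ‖y - z‖ ^ 2) (𝓝[K] z) (𝓝 0) := by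
    have hc : Continuous (fun y => Q * ‖y - z‖ + C * ‖y - z‖ ^ 2) := by fun_prop
    have := (hc.tendsto z).mono_left (nhdsWithin_le_nhds (s := K))
    simpa using this
  refine squeeze_zero' (Eventually.of_forall fun y => dist_nonneg) ?_ ht
  filter_upwards [self_mem_nhdsWithin] with y hy
  exact hb y hy

/-- The theorem on sums in the Heisenberg group. -/
theorem theorem_on_sums (a b c : ℝ) {Ω : Set (Heis n)} (hΩ : IsOpen Ω)
    (hK : IsCompact (closure Ω)) {V U : Heis n → ℝ}
    (hV : UpperSemicontinuousOn V (closure Ω)) (hU : UpperSemicontinuousOn U (closure Ω))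
    {s : ℝ} (hfr : ∀ ξ ∈ closure Ω, ξ ∉ Ω → V ξ + U ξ ≤ s)
    {ξs : Heis n} (hξs : ξs ∈ Ω) (hgt : s < V ξs + U ξs) {κ : ℝ} (hκ : 0 < κ) :
    ∃ η1 ∈ Ω, ∃ η2 ∈ Ω, s < V η1 + U η2 ∧ ∃ (q r : HIdx n → ℝ) (τ1 M1 τ2 M2 : ℝ) (A B : HMat n),
      A.IsSymm ∧ B.IsSymm ∧
      (∀ᶠ ζ in 𝓝 (0 : Heis n), η1 + linH η1 ζ ∈ Ω →
        V (η1 + linH η1 ζ) ≤ V η1 + qpoly q τ1 A M1 ζ) ∧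
      (∀ᶠ ζ in 𝓝 (0 : Heis n), η2 + linH η2 ζ ∈ Ω →
        U (η2 + linH η2 ζ) ≤ U η2 + qpoly r τ2 B M2 ζ) ∧
      (∀ x : HIdx n → ℝ, x ⬝ᵥ (A *ᵥ x) + x ⬝ᵥ (B *ᵥ x) ≤ κ * (x ⬝ᵥ x)) ∧
      (∀ x : HIdx n → ℝ, |x ⬝ᵥ (Lq a b c r *ᵥ x) - x ⬝ᵥ (Lq a b c q *ᵥ x)| ≤ κ * (x ⬝ᵥ x)) := by
  set K := closure Ω with hKdef
  have hΩK : Ω ⊆ K := subset_closure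
  have hne : K.Nonempty := ⟨ξs, hΩK hξs⟩
  set d := V ξs + U ξs - s with hd
  have hd0 : 0 < d := by linarith
  obtain ⟨ν, hν, hgap⟩ := penalty_gap hΩ hK hV hU (s := s) (s' := s + d / 2) (by linarith) hfr
  obtain ⟨zV, hzV, hmV⟩ := hV.exists_isMaxOn hne hK
  obtain ⟨zU, hzU, hmU⟩ := hU.exists_isMaxOn hne hK
  have hmV' : ∀ y ∈ K, V y ≤ V zV := fun y hy => hmV hy
  have hmU' : ∀ y ∈ K, U y ≤ U zU := fun y hy => hmU hy
  set Bd := V zV + U zU - s with hBd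
  have hBd0 : 0 < Bd := by
    have := hmV' ξs (hΩK hξs)
    have := hmU' ξs (hΩK hξs)
    linarith
  set l := Bd / ν with hl
  have hl0 : 0 < l := by positivity
  have hlν : l * ν = Bd := by rw [hl, div_mul_cancel₀]; exact hν.ne'
  obtain ⟨F, e1, q1, C1, Q1, hC1, he1, hF1, hF2, hF3, hF4⟩ := sup_convolution hK hne hV hl0
  obtain ⟨G, e2, q2, C2, Q2, hC2, he2, hG1, hG2, hG3, hG4⟩ := sup_convolution hK hne hU hl0
  have hFc := semiconvex_continuousOn hF3 hF4
  have hGc := semiconvex_continuousOn hG3 hG4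
  have hFV : ∀ ξ ∈ K, V ξ ≤ F ξ := by
    intro ξ hξ
    have := hF2 ξ ξ hξ
    simpa [Nq_zero] using this
  have hGU : ∀ ξ ∈ K, U ξ ≤ G ξ := by
    intro ξ hξ
    have := hG2 ξ ξ hξ
    simpa [Nq_zero] using this
  have hloc : ∀ x ∈ K, s + d / 2 ≤ F x + G x →
      (x ∈ Ω ∧ e1 x ∈ Ω ∧ e2 x ∈ Ω) ∧ s < V (e1 x) + U (e2 x) := by
    intro x hx hxs
    have n1 := mul_nonneg hl0.le (Nq_nonneg (linH (e1 x) (x - e1 x)))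
    have n2 := mul_nonneg hl0.le (Nq_nonneg (linH (e2 x) (x - e2 x)))
    have h1 := hF1 x
    have h2 := hG1 x
    have h3 := hmV' _ (he1 x)
    have h4 := hmU' _ (he2 x)
    refine ⟨hgap x hx _ (he1 x) _ (he2 x) (by linarith) ?_, by linarith⟩
    refine lt_of_mul_lt_mul_left (a := l) ?_ hl0.le
    rw [hlν, mul_add]
    linarith
  set D : Set (Heis n) := K ∩ (fun x => F x + G x) ⁻¹' Set.Ici (s + 3 * d / 4) with hDdef
  have hDc : IsCompact D := by
    have : IsClosed D := (hFc.add hGc).preimage_isClosed_of_isClosed hK.isClosed isClosed_Ici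
    exact hK.of_isClosed_subset this Set.inter_subset_left
  have hDΩ : D ⊆ Ω := by
    intro x hx
    have h2 : s + 3 * d / 4 ≤ F x + G x := hx.2
    exact (hloc x hx.1 (by linarith)).1.1
  obtain ⟨δ, hδ, hδΩ⟩ := hDc.exists_cthickening_subset_open hΩ hDΩ
  obtain ⟨R, hR⟩ := hK.isBounded.exists_norm_le
  have hR0 : 0 ≤ R := (norm_nonneg _).trans (hR _ (hΩK hξs))
  obtain ⟨Gb, hGb, hgrad⟩ := gradH_bound hK
  set Q := max (max Q1 Q2) 0 with hQ
  have hQ0 : 0 ≤ Q := le_max_right _ _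
  obtain ⟨ρ1, hρ1, hLq⟩ := Lq_cont (n := n) a b c (K := Gb * Q ^ 2) (κ := κ) (by positivity) hκ
  set ρ := min 1 (min (ρ1 / (Gb + 1)) (d / (8 * (R + 1)))) with hρ
  have hρ0 : 0 < ρ := by
    refine lt_min one_pos (lt_min ?_ ?_) <;> positivity
  have hρa : ρ ≤ 1 := min_le_left _ _
  have hρb : ρ * (Gb + 1) ≤ ρ1 := by
    rw [← le_div_iff₀ (by positivity)]
    exact (min_le_right _ _).trans (min_le_left _ _)
  have hρc : ρ * (8 * (R + 1)) ≤ d := by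
    rw [← le_div_iff₀ (by positivity)]
    exact (min_le_right _ _).trans (min_le_right _ _)
  have hρd : Gb * ρ ^ 2 ≤ ρ1 := by nlinarith [mul_nonneg hGb hρ0.le]
  obtain ⟨x, hxD, A, B, hqr, hAB, hexA, hexB⟩ := jensen_alexandrov (f := F) (g := G) (q := q1)
    (r := q2) (C := max C1 C2) (Q := Q) (d := δ) (ρ := ρ) (Kb := K) (D := D) hδ
    (hC1.trans (le_max_left _ _)) hρ0
    (fun x hx => ((Metric.closedBall_subset_cthickening hx δ).trans hδΩ).trans hΩK)
    (fun z _ y _ => by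
      have := hF3 z y
      have h2 := mul_le_mul_of_nonneg_right (le_max_left C1 C2) (sq_nonneg ‖y - z‖)
      linarith)
    (fun z _ y _ => by
      have := hG3 z y
      have h2 := mul_le_mul_of_nonneg_right (le_max_right C1 C2) (sq_nonneg ‖y - z‖)
      linarith)
    (fun z hz => (hF4 z hz).trans ((le_max_left _ _).trans (le_max_left _ _)))
    (fun z hz => (hG4 z hz).trans ((le_max_right _ _).trans (le_max_left _ _)))
    (fun p hp => by
      have hc : ContinuousOn (fun y => F y + G y - p y) K :=
        (hFc.add hGc).sub p.continuous.continuousOn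
      obtain ⟨x, hx, hm⟩ := hK.exists_isMaxOn hne hc
      refine ⟨x, ⟨hx, ?_⟩, fun y hy => hm hy⟩
      have h1 : F ξs + G ξs - p ξs ≤ F x + G x - p x := hm (hΩK hξs)
      have h2 := hFV ξs (hΩK hξs)
      have h3 := hGU ξs (hΩK hξs)
      have h4 : |p (ξs - x)| ≤ ρ * (R + R) :=
        (p.le_opNorm _).trans (mul_le_mul hp ((norm_sub_le _ _).trans
          (add_le_add (hR _ (hΩK hξs)) (hR _ hx))) (norm_nonneg _) hρ0.le)
      rw [map_sub] at h4
      have h5 := (abs_le.1 h4).2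
      show s + 3 * d / 4 ≤ F x + G x
      nlinarith)
  have hxK : x ∈ K := hxD.1
  have hxs : s + 3 * d / 4 ≤ F x + G x := hxD.2
  obtain ⟨⟨hxΩ, hη1, hη2⟩, hs⟩ := hloc x hxK (by linarith)
  obtain ⟨τ1, M1, hj1⟩ := euclid_to_jet hexA (ε := κ / 2) (by positivity)
  obtain ⟨τ2, M2, hj2⟩ := euclid_to_jet hexB (ε := κ / 2) (by positivity)
  have hJ1 := sup_conv_jet (hF1 x) hF2 hj1
  have hJ2 := sup_conv_jet (hG1 x) hG2 hj2
  have hIs : ((κ / 2) • (1 : HMat n)).IsSymm := by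
    rw [Matrix.IsSymm, Matrix.transpose_smul, Matrix.transpose_one]
  refine ⟨e1 x, hη1, e2 x, hη2, hs, gradH x (q1 x), gradH x (q2 x), τ1, M1, τ2, M2,
    hessH x A + (κ / 2) • (1 : HMat n), hessH x B + (κ / 2) • (1 : HMat n),
    (hessH_isSymm x A).add hIs, (hessH_isSymm x B).add hIs, ?_, ?_, ?_, ?_⟩
  · filter_upwards [hJ1] with ζ hζ h using hζ (hΩK h)
  · filter_upwards [hJ2] with ζ hζ h using hζ (hΩK h)
  · intro z
    have h1 := hAB (linH x (embH n z))
    rw [← hessH_quad, ← hessH_quad] at h1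
    simp only [Matrix.add_mulVec, dotProduct_add, Matrix.smul_mulVec, Matrix.one_mulVec,
      dotProduct_smul, smul_eq_mul]
    linarith
  · apply hLq
    · refine (hgrad x hxK _).trans ?_
      have : ‖q1 x‖ ≤ Q := (hF4 x hxK).trans ((le_max_left _ _).trans (le_max_left _ _))
      gcongr
    · rw [← gradH_add]
      refine (hgrad x hxK _).trans (le_trans ?_ hρd)
      gcongr

theorem comparison_main
    (Ω : Set (Heis n)) (hΩopen : IsOpen Ω) (hΩbdd : Bornology.IsBounded Ω)
    (S : Set (HMat n)) (hSsymm : ∀ A ∈ S, A.IsSymm)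
    (hSpos : ∀ A ∈ S, ∀ B : HMat n, B.PosDef → A + B ∈ S)
    (hScone : ∀ A ∈ S, ∀ c : ℝ, 0 < c → c • A ∈ S)
    (a b c : ℝ)
    (hstruct : (0 < b ∧ 0 ≤ c) ∨ (b < 0 ∧ c ≤ 0) ∨ (b = 0 ∧ c = 0))
    (w v : Heis n → EReal)
    (hw : LSCFun (closure Ω) w) (hv : USCFun (closure Ω) v)
    (hwsuper : IsSupersolution Ω (LquadC a b c) S w)
    (hvsub : IsSubsolution Ω (LquadC a b c) S v)
    (hbdry : ∀ ξ ∈ frontier Ω, v ξ ≤ w ξ) :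
    ∀ ξ ∈ Ω, v ξ ≤ w ξ := by
  intro ξs hξs
  by_contra hcon
  push Not at hcon
  have hK : IsCompact (closure Ω) := hΩbdd.isCompact_closure
  have hΩK : Ω ⊆ closure Ω := subset_closure
  have hnw : UpperSemicontinuousOn (fun ξ => - w ξ) (closure Ω) := by
    intro ξ hξ y hy
    have h1 : -y < w ξ := EReal.neg_lt_comm.1 hy
    filter_upwards [hw.1 ξ hξ (-y) h1] with η hη
    exact EReal.neg_lt_comm.1 hη
  obtain ⟨Mv, hMv0, hMv⟩ := usc_bound hK hv.1 hv.2.1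
  obtain ⟨Mw, hMw0, hMw⟩ := usc_bound hK hnw (fun ξ hξ h => hw.2.1 ξ hξ (EReal.neg_eq_top_iff.1 h))
  set M := max Mv Mw with hMdef
  have hM0 : 0 ≤ M := hMv0.trans (le_max_left _ _)
  have hMv' : ∀ ξ ∈ closure Ω, v ξ ≤ (M : EReal) := fun ξ hξ =>
    (hMv ξ hξ).trans (by exact_mod_cast le_max_left _ _)
  have hMw' : ∀ ξ ∈ closure Ω, - w ξ ≤ (M : EReal) := fun ξ hξ =>
    (hMw ξ hξ).trans (by exact_mod_cast le_max_right _ _)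
  obtain ⟨v1, hv1usc, hv1⟩ := usc_trunc (N := -(M + 1)) hv.1 hMv'
  obtain ⟨u1, hu1usc, hu1⟩ := usc_trunc (N := -(M + 1)) hnw hMw'
  have hv1l : ∀ ξ ∈ closure Ω, -(M + 1) ≤ v1 ξ := fun ξ hξ => by
    have : ((-(M + 1) : ℝ) : EReal) ≤ (v1 ξ : EReal) := by rw [hv1 ξ hξ]; exact le_max_right _ _
    exact_mod_cast this
  have hcoe : ((-(M + 1) : ℝ) : EReal) ≤ (M : EReal) := by
    have : -(M + 1) ≤ M := by linarith
    exact_mod_cast this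
  have hv1u : ∀ ξ ∈ closure Ω, v1 ξ ≤ M := fun ξ hξ => by
    have : (v1 ξ : EReal) ≤ (M : EReal) := by
      rw [hv1 ξ hξ]; exact max_le (hMv' ξ hξ) hcoe
    exact_mod_cast this
  have hu1u : ∀ ξ ∈ closure Ω, u1 ξ ≤ M := fun ξ hξ => by
    have : (u1 ξ : EReal) ≤ (M : EReal) := by
      rw [hu1 ξ hξ]; exact max_le (hMw' ξ hξ) hcoe
    exact_mod_cast this
  have hvv1 : ∀ ξ ∈ closure Ω, v ξ ≤ (v1 ξ : EReal) := fun ξ hξ => by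
    rw [hv1 ξ hξ]; exact le_max_left _ _
  have hwu1 : ∀ ξ ∈ closure Ω, ((-u1 ξ : ℝ) : EReal) ≤ w ξ := fun ξ hξ => by
    rw [EReal.coe_neg]
    apply EReal.neg_le_of_neg_le
    rw [hu1 ξ hξ]; exact le_max_left _ _
  have hveq : ∀ ξ ∈ closure Ω, -(M + 1) < v1 ξ → v ξ = (v1 ξ : EReal) := by
    intro ξ hξ h
    have h1 := hv1 ξ hξ
    rcases max_choice (v ξ) ((-(M + 1) : ℝ) : EReal) with h2 | h2
    · rw [h1, h2]
    · rw [h2] at h1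
      have : v1 ξ = -(M + 1) := by exact_mod_cast h1
      linarith
  have hweq : ∀ ξ ∈ closure Ω, -(M + 1) < u1 ξ → w ξ = ((-u1 ξ : ℝ) : EReal) := by
    intro ξ hξ h
    have h1 := hu1 ξ hξ
    rcases max_choice (- w ξ) ((-(M + 1) : ℝ) : EReal) with h2 | h2
    · rw [EReal.coe_neg, h1, h2, neg_neg]
    · rw [h2] at h1
      have : u1 ξ = -(M + 1) := by exact_mod_cast h1
      linarith
  -- the boundary inequality and the interior violation
  have hfr : ∀ ξ ∈ closure Ω, ξ ∉ Ω → v1 ξ + u1 ξ ≤ 0 := by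
    intro ξ hξ hn
    have hvw := hbdry ξ ⟨hξ, by rwa [hΩopen.interior_eq]⟩
    by_contra hc
    push Not at hc
    have h1 := hu1u ξ hξ
    have h2 := hv1u ξ hξ
    rw [hveq ξ hξ (by linarith), hweq ξ hξ (by linarith)] at hvw
    have : v1 ξ ≤ -u1 ξ := by exact_mod_cast hvw
    linarith
  have hpos : 0 < v1 ξs + u1 ξs := by
    have hξK := hΩK hξs
    by_contra hc
    push Not at hc
    have h1 := hvv1 ξs hξK
    have h2 := hwu1 ξs hξK
    have h3 : (v1 ξs : EReal) ≤ ((-u1 ξs : ℝ) : EReal) := by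
      have : v1 ξs ≤ -u1 ξs := by linarith
      exact_mod_cast this
    exact absurd (h1.trans (h3.trans h2)) (not_le.2 hcon)
  set m := v1 ξs + u1 ξs with hm
  obtain ⟨κ, hκ, V, hVusc, hVv1, hVjet⟩ := strict_transform hΩbdd hSsymm hSpos hScone hstruct hvsub
    hv1usc (R := M + 1) (fun ξ hξ => abs_le.2 ⟨hv1l ξ hξ, by linarith [hv1u ξ hξ]⟩) (by linarith)
    (fun ξ hξ => hvv1 ξ (hΩK hξ)) (θ := m / 4) (by linarith)
  obtain ⟨η1, hη1, η2, hη2, hs, q, r, τ1, M1, τ2, M2, A, B, hA, hB, hj1, hj2, hAB, hL⟩ :=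
    theorem_on_sums a b c hΩopen hK hVusc hu1usc (s := m / 4)
      (fun ξ hξ hn => by
        have := (abs_le.1 (hVv1 ξ hξ)).2
        linarith [hfr ξ hξ hn])
      hξs (by
        have := (abs_le.1 (hVv1 ξs (hΩK hξs))).1
        linarith) (κ := κ / 4) (by linarith)
  have hcontact : 0 < v1 η1 + u1 η2 := by
    have := (abs_le.1 (hVv1 η1 (hΩK hη1))).2
    linarith
  have hmem := hVjet η1 hη1 (hveq η1 (hΩK hη1) (by linarith [hu1u η2 (hΩK hη2)])) q τ1 A M1 hA hj1
  have hnot := super_jet hwsuper hη2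
    (hweq η2 (hΩK hη2) (by linarith [hv1u η1 (hΩK hη1)])) (q := -r) (A := -B) (τ := -τ2) (M := -M2)
    hB.neg (by
      filter_upwards [hj2] with ζ hζ hmemΩ
      refine le_trans ?_ (hwu1 _ (hΩK hmemΩ))
      have h1 := hζ hmemΩ
      have h2 : qpoly (-r) (-τ2) (-B) (-M2) ζ = - qpoly r τ2 B M2 ζ := by
        simp only [qpoly, neg_dotProduct, Matrix.neg_mulVec, dotProduct_neg]
        ring
      rw [h2]
      have h3 : -u1 η2 + -qpoly r τ2 B M2 ζ ≤ -u1 (η2 + linH η2 ζ) := by linarith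
      exact_mod_cast h3)
  rw [Lq_neg] at hnot
  apply hnot
  have hone : (κ • (1 : HMat n)).IsSymm := by
    rw [Matrix.IsSymm, Matrix.transpose_smul, Matrix.transpose_one]
  have hfin := closure_add_mem hSsymm hSpos (κ := κ / 2) (by linarith) hmem
    (B := (-B + Lq a b c r) - (A + Lq a b c q - κ • (1 : HMat n)))
    ((hB.neg.add (Lq_isSymm a b c r)).sub ((hA.add (Lq_isSymm a b c q)).sub hone)) (by
      intro x
      have h1 := hAB x
      have h2 := (abs_le.1 (hL x)).1
      simp only [Matrix.add_mulVec, Matrix.sub_mulVec, dotProduct_add, dotProduct_sub,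
        Matrix.smul_mulVec, Matrix.one_mulVec, Matrix.neg_mulVec, dotProduct_neg,
        dotProduct_smul, smul_eq_mul]
      linarith)
  rwa [add_sub_cancel] at hfin

end Assembly

/-- Comparison principle for the constant-coefficient quadratic operators on `ℍⁿ`. -/
theorem comparison_principle_constant_coefficients
    {n : ℕ} (hn : 1 ≤ n)
    (Ω : Set (Heis n)) (hΩopen : IsOpen Ω) (hΩbdd : Bornology.IsBounded Ω)
    (S : Set (HMat n)) (hSne : S.Nonempty) (hSsymm : ∀ A ∈ S, A.IsSymm)
    (hSopen : RelOpen S)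
    (hSpos : ∀ A ∈ S, ∀ B : HMat n, B.PosDef → A + B ∈ S)
    (hScone : ∀ A ∈ S, ∀ c : ℝ, 0 < c → c • A ∈ S)
    (a b c : ℝ)
    (hstruct : (0 < b ∧ 0 ≤ c) ∨ (b < 0 ∧ c ≤ 0) ∨ (b = 0 ∧ c = 0))
    (w v : Heis n → EReal)
    (hw : LSCFun (closure Ω) w) (hv : USCFun (closure Ω) v)
    (hwsuper : IsSupersolution Ω (LquadC a b c) S w)
    (hvsub : IsSubsolution Ω (LquadC a b c) S v)
    (hbdry : ∀ ξ ∈ frontier Ω, v ξ ≤ w ξ) :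
    ∀ ξ ∈ Ω, v ξ ≤ w ξ := by
  exact comparison_main Ω hΩopen hΩbdd S hSsymm hSpos hScone a b c hstruct w v hw hv hwsuper
    hvsub hbdry
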